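/- arXiv:math-ph/0605050 — 2 statements merged into one kernel-verified Lean document; each statement's English description precedes it below -/
import Mathlib

section
/- Lower bound for approximation by entire families of exponential type: let W = {z ∈ ℂ : Re z > 0}, and let N ≥ 2, M ≥ 0 be integers. Let f(x,ζ,w), for x ∈ I^s, ζ ∈ ℂ^N, w ∈ W^M, be continuous in x, entire in ζ and holomorphic in w, and assume the growth bound: for all (ζ,w) ∈ ℂ^N × W^M, sup_{x ∈ I^s} |f(x,ζ,w)| ≤ A·e^{u(N+M)^v}·e^{b(N+M)^t(‖ζ‖₁^d + ‖w‖₁^d)}, where A,u,v,b,t,d ∈ [1,∞) and ‖ζ‖₁ = |ζ₁|+…+|ζ_N| (similarly ‖w‖₁). Let Ω_{N,M} = {(ζ,w) ∈ ℝ^N × (ℝ₊)^M : |ζ_j| ≤ B₁(M+N)^{r₁} for all j, |w_i − a_i| ≤ (1−ε)a_i for all i}, where each a_i ≤ B₂(M+N)^{r₂}, B₁, B₂, r₁, r₂ ≥ 1 and 0 < ε < 1. Then, for l = m + α (m ∈ ℕ, 0 < α ≤ 1), there exist a constant C > 0 depending only on l, s and the constants A,u,v,b,t,d,B₁,B₂,r₁,r₂,ε,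 and a function h ∈ Λ_l(I^s), such that for all (ζ,w) ∈ Ω_{N,M}: ‖h − f(·,ζ,w)‖_∞ ≥ C / ((M+N)·log(M+N))^{l/s}. -/
open Set

noncomputable section
/-- The unit cube `I^s = [0,1]^s` in `ℝ^s` (with the Euclidean norm). -/
def cube (s : ℕ) : Set (EuclideanSpace ℝ (Fin s)) :=
  {x | ∀ i, x i ∈ Icc (0:ℝ) 1}

/-- The Hölder class `Λ_l(I^s)` with `l = m + α`, `0 < α ≤ 1`. -/
def HolderClass (s m : ℕ) (α : ℝ) (f : EuclideanSpace ℝ (Fin s) → ℝ) : Prop :=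
  ContDiffOn ℝ m f (cube s) ∧
  (∀ j ≤ m, ∀ x ∈ cube s, ‖iteratedFDerivWithin ℝ j f (cube s) x‖ ≤ 1) ∧
  ∀ x ∈ cube s, ∀ y ∈ cube s,
    ‖iteratedFDerivWithin ℝ m f (cube s) x - iteratedFDerivWithin ℝ m f (cube s) y‖
      ≤ ‖x - y‖ ^ α

/-- The product `W^M` of half-planes `W = {Re z > 0}`. -/
def Wset (M : ℕ) : Set (Fin M → ℂ) := {w | ∀ i, 0 < (w i).re}

lemma aux_interp (L : ℕ) (hL : 0 < L) (r : ℝ) (hr : 0 < r) :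
    ∃ (ω : Fin L → ℂ) (ℓ : Fin L → Polynomial ℂ), (∀ g, ‖ω g‖ = r) ∧
      (∀ g, (ℓ g).natDegree ≤ L) ∧ (∀ g z, ‖z‖ ≤ r → ‖(ℓ g).eval z‖ ≤ 1) ∧
      ∀ k < L, ∀ z, ∑ g, (ω g) ^ k * (ℓ g).eval z = z ^ k := by
  have hL' : (L : ℂ) ≠ 0 := by exact_mod_cast hL.ne'
  have hξ := Complex.isPrimitiveRoot_exp L hL.ne'
  set ξ := Complex.exp (2 * Real.pi * Complex.I / L) with hξd
  have hξ0 : ξ ≠ 0 := Complex.exp_ne_zero _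
  have hξn : ‖ξ‖ = 1 := hξ.norm'_eq_one hL.ne'
  have hr0 : (r : ℂ) ≠ 0 := by exact_mod_cast hr.ne'
  refine ⟨fun g => r * ξ ^ (g : ℕ), fun g => ∑ i ∈ Finset.range L,
    Polynomial.C (1 / (L : ℂ) * ((r * ξ ^ (g : ℕ))⁻¹) ^ i) * Polynomial.X ^ i, ?_, ?_, ?_, ?_⟩
  · intro g
    simp [hξn, abs_of_pos hr]
  · intro g
    refine Polynomial.natDegree_sum_le_of_forall_le _ _ ?_
    intro i hi
    refine (Polynomial.natDegree_C_mul_X_pow_le _ _).trans ?_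
    exact (Finset.mem_range.1 hi).le
  · intro g z hz
    rw [Polynomial.eval_finsetSum]
    refine (norm_sum_le_of_le (f := _) (n := fun _ => 1 / (L : ℝ)) _ ?_).trans ?_
    · intro i _
      simp only [Polynomial.eval_mul, Polynomial.eval_C, Polynomial.eval_pow, Polynomial.eval_X,
        norm_mul, norm_div, norm_one, norm_pow, norm_inv, hξn, one_pow, mul_one,
        Complex.norm_natCast, Complex.norm_real, Real.norm_eq_abs, abs_of_pos hr]
      rw [mul_assoc, ← mul_pow]
      have : r⁻¹ * ‖z‖ ≤ 1 := by
        rw [inv_mul_le_iff₀ hr]; simpa using hz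
      have := pow_le_one₀ (n := i) (by positivity) this
      have h2 : 0 ≤ 1 / (L : ℝ) := by positivity
      nlinarith
    · have : (L : ℝ) ≠ 0 := by exact_mod_cast hL.ne'
      simp [this]
  · intro k hk z
    have orth : ∀ i < L, ∑ g : Fin L, (r * ξ ^ (g : ℕ)) ^ k * ((r * ξ ^ (g : ℕ))⁻¹) ^ i
        = if i = k then (L : ℂ) else 0 := by
      intro i hi
      split_ifs with h
      · subst h
        have : ∀ g : Fin L, (r * ξ ^ (g : ℕ)) ^ i * ((r * ξ ^ (g : ℕ))⁻¹) ^ i = 1 := by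
          intro g
          rw [← mul_pow, mul_inv_cancel₀, one_pow]
          exact mul_ne_zero hr0 (pow_ne_zero _ hξ0)
        simp only [this]; simp
      · have e : ∀ g : Fin L, (r * ξ ^ (g : ℕ)) ^ k * ((r * ξ ^ (g : ℕ))⁻¹) ^ i
            = (r : ℂ) ^ k * (r : ℂ)⁻¹ ^ i * (ξ ^ k * ξ⁻¹ ^ i) ^ (g : ℕ) := by
          intro g
          rw [mul_inv, mul_pow, mul_pow, mul_pow, ← inv_pow]
          ring
        simp only [e]
        rw [← Finset.mul_sum, Fin.sum_univ_eq_sum_range (fun g => (ξ ^ k * ξ⁻¹ ^ i) ^ g) L]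
        have hx : (ξ ^ k * ξ⁻¹ ^ i) ^ L = 1 := by
          rw [mul_pow, ← pow_mul, ← pow_mul, mul_comm k, mul_comm i, pow_mul, pow_mul, inv_pow,
            hξ.pow_eq_one]
          simp
        have hne : ξ ^ k * ξ⁻¹ ^ i ≠ 1 := by
          intro h1
          have : ξ ^ k = ξ ^ i := by
            rw [inv_pow, mul_inv_eq_one₀ (pow_ne_zero _ hξ0)] at h1
            exact h1
          exact h (hξ.pow_inj hk hi this).symm
        have := mul_geom_sum (ξ ^ k * ξ⁻¹ ^ i) L
        rw [hx, sub_self] at this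
        rw [(mul_eq_zero.1 this).resolve_left (sub_ne_zero.2 hne), mul_zero]
    calc _ = ∑ g : Fin L, ∑ i ∈ Finset.range L, (r * ξ ^ (g : ℕ)) ^ k * ((r * ξ ^ (g : ℕ))⁻¹) ^ i
            * (z ^ i / L) := by
          refine Finset.sum_congr rfl fun g _ => ?_
          rw [Polynomial.eval_finsetSum, Finset.mul_sum]
          refine Finset.sum_congr rfl fun i _ => ?_
          simp only [Polynomial.eval_mul, Polynomial.eval_C, Polynomial.eval_pow, Polynomial.eval_X]
          ring
      _ = ∑ i ∈ Finset.range L, (if i = k then (L : ℂ) else 0) * (z ^ i / L) := by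
          rw [Finset.sum_comm]
          refine Finset.sum_congr rfl fun i hi => ?_
          rw [← orth i (Finset.mem_range.1 hi), Finset.sum_mul]
      _ = z ^ k := by
          simp only [ite_mul, zero_mul]
          rw [Finset.sum_ite_eq']
          simp [hk]
          field_simp

lemma aux_coeff (g : ℂ → ℂ) (B : ℝ) (hg : DifferentiableOn ℂ g (Metric.ball 0 1))
    (hB : ∀ z ∈ Metric.ball (0:ℂ) 1, ‖g z‖ ≤ B) (k : ℕ) :
    ‖(k.factorial : ℂ)⁻¹ * iteratedDeriv k g 0‖ ≤ B := by
  have key : ∀ ρ ∈ Ioo (0:ℝ) 1, ‖(k.factorial : ℂ)⁻¹ * iteratedDeriv k g 0‖ * ρ ^ k ≤ B := by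
    intro ρ hρ
    have hsub : Metric.closedBall (0:ℂ) ρ ⊆ Metric.ball 0 1 := Metric.closedBall_subset_ball hρ.2
    have := Complex.norm_iteratedDeriv_le_of_forall_mem_sphere_norm_le (c := 0) (f := g) (C := B) k hρ.1
      (DifferentiableOn.diffContOnCl (by
        rw [closure_ball _ hρ.1.ne']; exact hg.mono hsub))
      (fun z hz => hB z (hsub (Metric.sphere_subset_closedBall hz)))
    have hk : (0:ℝ) < k.factorial := by exact_mod_cast k.factorial_pos
    have hρk : 0 < ρ ^ k := pow_pos hρ.1 k
    rw [norm_mul, norm_inv, Complex.norm_natCast]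
    rw [le_div_iff₀ hρk] at this
    rw [mul_assoc, inv_mul_le_iff₀ hk]
    exact this
  have ht : Filter.Tendsto (fun ρ : ℝ => ‖(k.factorial : ℂ)⁻¹ * iteratedDeriv k g 0‖ * ρ ^ k)
      (nhdsWithin 1 (Iio 1)) (nhds (‖(k.factorial : ℂ)⁻¹ * iteratedDeriv k g 0‖ * 1 ^ k)) := by
    refine Filter.Tendsto.mono_left ?_ nhdsWithin_le_nhds
    exact Continuous.tendsto (by fun_prop) _
  rw [one_pow, mul_one] at ht
  refine le_of_tendsto ht ?_
  filter_upwards [Ioo_mem_nhdsLT (show (0:ℝ) < 1 by norm_num)] with ρ hρ using key ρ hρ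

lemma aux_taylor (g : ℂ → ℂ) (B : ℝ) (hg : DifferentiableOn ℂ g (Metric.ball 0 1))
    (hB : ∀ z ∈ Metric.ball (0:ℂ) 1, ‖g z‖ ≤ B) (L : ℕ) (r : ℝ) (hr : 0 < r) (hr1 : r < 1)  :
    ∃ c : ℕ → ℂ, ∀ z : ℂ, ‖z‖ ≤ r →
      ‖g z - ∑ k ∈ Finset.range L, c k * z ^ k‖ ≤ B * r ^ L / (1 - r) := by
  refine ⟨fun k => (k.factorial : ℂ)⁻¹ * iteratedDeriv k g 0, fun z hz => ?_⟩
  have hz1 : z ∈ Metric.ball (0:ℂ) 1 := by simpa using hz.trans_lt hr1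
  have hs := Complex.hasSum_taylorSeries_on_ball (c := 0) (r := 1) (f := g) hg hz1
  have hs' : HasSum (fun k => (k.factorial : ℂ)⁻¹ * iteratedDeriv k g 0 * z ^ k) (g z) := by
    have e : (fun k : ℕ => (k.factorial : ℂ)⁻¹ * iteratedDeriv k g 0 * z ^ k)
        = fun n : ℕ => (n.factorial : ℂ)⁻¹ • (z - 0) ^ n • iteratedDeriv n g 0 := by
      funext k
      rw [smul_eq_mul, smul_eq_mul, sub_zero]
      ring
    rw [e]
    exact hs
  have hs2 := (hasSum_nat_add_iff' L).2 hs'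
  have hgeo := ((hasSum_geometric_of_lt_one hr.le hr1).mul_left (B * r ^ L))
  refine (hs2.norm_le_of_bounded hgeo ?_).trans (le_of_eq (by rw [div_eq_mul_inv]))
  intro k
  have h1 := aux_coeff g B hg hB (k + L)
  rw [norm_mul, norm_pow, mul_assoc, ← pow_add, add_comm L]
  exact mul_le_mul h1 (pow_le_pow_left₀ (norm_nonneg _) hz _) (by positivity) ((norm_nonneg _).trans h1)

lemma aux_one (L : ℕ) (r : ℝ) (hr : 0 < r) (hr1 : r < 1) (ω : Fin L → ℂ) (ℓ : Fin L → Polynomial ℂ)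
    (h1 : ∀ g, ‖ω g‖ = r) (h3 : ∀ g z, ‖z‖ ≤ r → ‖(ℓ g).eval z‖ ≤ 1)
    (h4 : ∀ k < L, ∀ z, ∑ g, (ω g) ^ k * (ℓ g).eval z = z ^ k)
    (g : ℂ → ℂ) (B : ℝ) (hg : DifferentiableOn ℂ g (Metric.ball 0 1))
    (hB : ∀ z ∈ Metric.ball (0:ℂ) 1, ‖g z‖ ≤ B) (z : ℂ) (hz : ‖z‖ ≤ r) :
    ‖g z - ∑ i, (ℓ i).eval z * g (ω i)‖ ≤ (1 + L) * (B * r ^ L / (1 - r)) := by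
  obtain ⟨c, hc⟩ := aux_taylor g B hg hB L r hr hr1
  have e : ∑ k ∈ Finset.range L, c k * z ^ k
      = ∑ i, (ℓ i).eval z * ∑ k ∈ Finset.range L, c k * (ω i) ^ k := by
    simp only [Finset.mul_sum]
    rw [Finset.sum_comm]
    refine Finset.sum_congr rfl fun k hk => ?_
    rw [← h4 k (Finset.mem_range.1 hk) z, Finset.mul_sum]
    refine Finset.sum_congr rfl fun i _ => by ring
  have e2 : g z - ∑ i, (ℓ i).eval z * g (ω i) = (g z - ∑ k ∈ Finset.range L, c k * z ^ k)
      - ∑ i, (ℓ i).eval z * (g (ω i) - ∑ k ∈ Finset.range L, c k * (ω i) ^ k) := by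
    simp only [mul_sub, Finset.sum_sub_distrib]
    rw [← e]; ring
  rw [e2]
  refine (norm_sub_le _ _).trans ?_
  have h5 : ‖∑ i, (ℓ i).eval z * (g (ω i) - ∑ k ∈ Finset.range L, c k * (ω i) ^ k)‖
      ≤ ∑ i : Fin L, (B * r ^ L / (1 - r)) := by
    refine norm_sum_le_of_le _ fun i _ => ?_
    rw [norm_mul]
    have := hc (ω i) (h1 i).le
    calc _ ≤ 1 * (B * r ^ L / (1 - r)) := mul_le_mul (h3 i z hz) this (norm_nonneg _) zero_le_one
      _ = _ := one_mul _
  simp at h5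
  have := hc z hz
  linarith

/-- polynomial approximation on polydiscs -/
lemma aux_poly (L : ℕ) (hL : 0 < L) (r : ℝ) (hr : 0 < r) (hr1 : r < 1) (B : ℝ) (hB0 : 0 ≤ B) (n : ℕ) :
    ∀ F : (Fin n → ℂ) → ℂ,
      (∀ j z, (∀ i, ‖z i‖ < 1) →
        DifferentiableOn ℂ (fun x => F (Function.update z j x)) (Metric.ball 0 1)) →
      (∀ z, (∀ i, ‖z i‖ < 1) → ‖F z‖ ≤ B) →
      ∃ P : MvPolynomial (Fin n) ℂ, P.totalDegree ≤ n * L ∧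
        ∀ z, (∀ i, ‖z i‖ ≤ r) →
          ‖F z - MvPolynomial.eval z P‖ ≤ n * (L:ℝ) ^ n * ((1 + L) * (B * r ^ L / (1 - r))) := by
  have hE : 0 ≤ (1 + L) * (B * r ^ L / (1 - r)) := by
    have : 0 < 1 - r := by linarith
    positivity
  obtain ⟨ω, ℓ, h1, h2, h3, h4⟩ := aux_interp L hL r hr
  set E := (1 + L) * (B * r ^ L / (1 - r)) with hEd
  induction n with
  | zero =>
    intro F _ _
    refine ⟨MvPolynomial.C (F 0), by simp, fun z _ => ?_⟩
    have : z = 0 := Subsingleton.elim _ _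
    simp [this]
  | succ n ih =>
    intro F hd hb
    have hω : ∀ g, ‖ω g‖ < 1 := fun g => (h1 g).trans_lt hr1
    have hcons : ∀ (x : ℂ) (z : Fin n → ℂ), ‖x‖ < 1 → (∀ i, ‖z i‖ < 1) →
        ∀ i, ‖(Fin.cons x z : Fin (n+1) → ℂ) i‖ < 1 := by
      intro x z hx hz i
      refine Fin.cases ?_ ?_ i
      · simpa using hx
      · intro j; simpa using hz j
    have key : ∀ g, ∃ P : MvPolynomial (Fin n) ℂ, P.totalDegree ≤ n * L ∧
        ∀ z, (∀ i, ‖z i‖ ≤ r) →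
          ‖F (Fin.cons (ω g) z) - MvPolynomial.eval z P‖ ≤ n * (L:ℝ) ^ n * E := by
      intro g
      refine ih (fun z => F (Fin.cons (ω g) z)) ?_ ?_
      · intro j z hz
        have := hd j.succ (Fin.cons (ω g) z) (hcons _ _ (hω g) hz)
        simpa only [Fin.cons_update] using this
      · intro z hz
        exact hb _ (hcons _ _ (hω g) hz)
    choose P hP1 hP2 using key
    refine ⟨∑ g, Polynomial.aeval (MvPolynomial.X 0) (ℓ g) * MvPolynomial.rename Fin.succ (P g), ?_, ?_⟩
    · refine MvPolynomial.totalDegree_finsetSum_le fun g _ => ?_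
      refine (MvPolynomial.totalDegree_mul _ _).trans ?_
      have ha : (Polynomial.aeval (MvPolynomial.X 0 : MvPolynomial (Fin (n+1)) ℂ) (ℓ g)).totalDegree ≤ L := by
        rw [Polynomial.aeval_eq_sum_range]
        refine MvPolynomial.totalDegree_finsetSum_le fun i hi => ?_
        refine (MvPolynomial.totalDegree_smul_le _ _).trans ?_
        refine (MvPolynomial.totalDegree_pow _ _).trans ?_
        rw [MvPolynomial.totalDegree_X, mul_one]
        exact (Nat.lt_succ_iff.1 (Finset.mem_range.1 hi)).trans (h2 g)
      have hb := (MvPolynomial.totalDegree_rename_le Fin.succ (P g)).trans (hP1 g)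
      calc _ ≤ L + n * L := add_le_add ha hb
        _ = (n+1) * L := by ring
    · intro z hz
      have hz1 : ∀ i, ‖z i‖ < 1 := fun i => (hz i).trans_lt hr1
      obtain ⟨x, y, rfl⟩ : ∃ x y, z = Fin.cons x y := ⟨z 0, Fin.tail z, (Fin.cons_self_tail z).symm⟩
      have hx : ‖x‖ ≤ r := by simpa using hz 0
      have hy : ∀ i, ‖y i‖ ≤ r := fun i => by simpa using hz i.succ
      have hy1 : ∀ i, ‖y i‖ < 1 := fun i => (hy i).trans_lt hr1
      have hone := aux_one L r hr hr1 ω ℓ h1 h3 h4 (fun x => F (Fin.cons x y)) B (by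
          have := hd 0 (Fin.cons 0 y) (hcons _ _ (by simp) hy1)
          simpa only [Fin.update_cons_zero] using this) (by
          intro x hx
          exact hb _ (hcons _ _ (by simpa using hx) hy1)) x hx
      have hev : MvPolynomial.eval (Fin.cons x y : Fin (n+1) → ℂ)
          (∑ g, Polynomial.aeval (MvPolynomial.X 0) (ℓ g) * MvPolynomial.rename Fin.succ (P g))
          = ∑ g, (ℓ g).eval x * MvPolynomial.eval y (P g) := by
        rw [map_sum]
        refine Finset.sum_congr rfl fun g _ => ?_
        rw [map_mul, MvPolynomial.eval_rename]
        congr 1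
        rw [Polynomial.aeval_def, Polynomial.hom_eval₂, Polynomial.eval]
        congr 1
        · ext a; simp
        · simp
      rw [hev]
      have e2 : F (Fin.cons x y) - ∑ g, (ℓ g).eval x * MvPolynomial.eval y (P g)
        = (F (Fin.cons x y) - ∑ i, (ℓ i).eval x * F (Fin.cons (ω i) y))
          + ∑ i, (ℓ i).eval x * (F (Fin.cons (ω i) y) - MvPolynomial.eval y (P i)) := by
        simp only [mul_sub, Finset.sum_sub_distrib]
        ring
      rw [e2]
      refine (norm_add_le _ _).trans ?_
      have h5 : ‖∑ i, (ℓ i).eval x * (F (Fin.cons (ω i) y) - MvPolynomial.eval y (P i))‖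
          ≤ ∑ i : Fin L, n * (L:ℝ) ^ n * E := by
        refine norm_sum_le_of_le _ fun i _ => ?_
        rw [norm_mul]
        have := hP2 i y hy
        calc _ ≤ 1 * (n * (L:ℝ) ^ n * E) := mul_le_mul (h3 i x hx) this (norm_nonneg _) zero_le_one
          _ = _ := one_mul _
      simp only [Finset.sum_const, Finset.card_univ, Fintype.card_fin, nsmul_eq_mul] at h5
      have hL1 : (1:ℝ) ≤ (L:ℝ) ^ (n+1) := one_le_pow₀ (by exact_mod_cast hL)
      have : E ≤ (L:ℝ) ^ (n+1) * E := le_mul_of_one_le_left hE hL1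
      calc _ ≤ E + L * (n * (L:ℝ) ^ n * E) := add_le_add hone h5
        _ ≤ (L:ℝ) ^ (n+1) * E + L * (n * (L:ℝ) ^ n * E) := by linarith
        _ = _ := by push_cast; ring

lemma aux_rank {S : Type*} [Fintype S] [DecidableEq S] (n D : ℕ) (p : S → Fin n → ℂ)
    (Φ : S → MvPolynomial (Fin n) ℂ) (hdeg : ∀ τ, (Φ τ).totalDegree ≤ D)
    (hdom : ∀ σ, ∑ τ ∈ Finset.univ.erase σ, ‖MvPolynomial.eval (p σ) (Φ τ)‖
      < ‖MvPolynomial.eval (p σ) (Φ σ)‖) :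
    Fintype.card S ≤ (D + 1) ^ n := by
  classical
  have hdet := det_ne_zero_of_sum_row_lt_diag (A := Matrix.of fun σ τ => MvPolynomial.eval (p σ) (Φ τ))
    (by simpa using hdom)
  have hli : LinearIndependent ℂ Φ := by
    rw [Fintype.linearIndependent_iff]
    intro c hc
    have : (Matrix.of fun σ τ => MvPolynomial.eval (p σ) (Φ τ)).mulVec c = 0 := by
      ext σ
      have := congrArg (MvPolynomial.eval (p σ)) hc
      simp only [map_sum, MvPolynomial.smul_eval, map_zero] at this
      simp only [Matrix.mulVec, dotProduct, Matrix.of_apply, Pi.zero_apply]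
      rw [← this]
      exact Finset.sum_congr rfl fun _ _ => mul_comm _ _
    have := Matrix.eq_zero_of_mulVec_eq_zero hdet this
    intro i; exact congrFun this i
  let T : Finset (MvPolynomial (Fin n) ℂ) := (Finset.univ : Finset (Fin n → Fin (D+1))).image
    fun e => MvPolynomial.monomial (Finsupp.equivFunOnFinite.symm fun i => (e i : ℕ)) 1
  have hcard : T.card ≤ (D+1)^n := by
    refine Finset.card_image_le.trans ?_
    simp
  have hspan : Set.range Φ ≤ Submodule.span ℂ (T : Set (MvPolynomial (Fin n) ℂ)) := by
    rintro _ ⟨τ, rfl⟩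
    change Φ τ ∈ Submodule.span ℂ (T : Set (MvPolynomial (Fin n) ℂ))
    rw [(Φ τ).as_sum]
    refine Submodule.sum_mem _ fun e he => ?_
    have : MvPolynomial.monomial e (MvPolynomial.coeff e (Φ τ))
        = (MvPolynomial.coeff e (Φ τ)) • MvPolynomial.monomial e (1:ℂ) := by
      rw [MvPolynomial.smul_monomial, smul_eq_mul, mul_one]
    rw [this]
    refine Submodule.smul_mem _ _ (Submodule.subset_span ?_)
    have hle : ∀ i, e i < D + 1 := fun i => by
      have h1 := (MvPolynomial.le_totalDegree he).trans (hdeg τ)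
      have h2 : e i ≤ e.sum fun _ k => k := by
        rw [Finsupp.sum_fintype _ _ (by simp)]
        exact Finset.single_le_sum (f := fun i => e i) (fun _ _ => Nat.zero_le _) (Finset.mem_univ i)
      omega
    simp only [T, Finset.coe_image, Set.mem_image]
    refine ⟨fun i => ⟨e i, hle i⟩, by simp, ?_⟩
    congr 1
    ext i; simp
  have h := linearIndependent_le_span_aux' Φ hli (T : Set (MvPolynomial (Fin n) ℂ)) hspan
  simp only [Finset.coe_sort_coe, Fintype.card_coe] at h
  exact h.trans hcard

/-- smoothstep iteration -/
noncomputable def smooth {R : Type*} [CommRing R] (x : R) : ℕ → R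
  | 0 => x
  | j + 1 => 3 * smooth x j ^ 2 - 2 * smooth x j ^ 3

lemma smooth_map {R S : Type*} [CommRing R] [CommRing S] (φ : R →+* S) (x : R) (j : ℕ) :
    φ (smooth x j) = smooth (φ x) j := by
  induction j with
  | zero => rfl
  | succ j ih => simp only [smooth, map_sub, map_mul, map_pow, ih, map_ofNat]

lemma smooth_deg {σ : Type*} (x : MvPolynomial σ ℂ) (D : ℕ) (h : x.totalDegree ≤ D) (j : ℕ) :
    (smooth x j).totalDegree ≤ 3 ^ j * D := by
  induction j with
  | zero => simpa [smooth] using h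
  | succ j ih =>
    have e : smooth x (j+1) = MvPolynomial.C 3 * smooth x j ^ 2 - MvPolynomial.C 2 * smooth x j ^ 3 := by
      have h3 : (MvPolynomial.C 3 : MvPolynomial σ ℂ) = 3 := map_ofNat _ 3
      have h2 : (MvPolynomial.C 2 : MvPolynomial σ ℂ) = 2 := map_ofNat _ 2
      rw [h3, h2]; rfl
    rw [e]
    refine (MvPolynomial.totalDegree_sub _ _).trans (max_le ?_ ?_)
    · refine (MvPolynomial.totalDegree_mul _ _).trans ?_
      rw [MvPolynomial.totalDegree_C, zero_add]
      refine (MvPolynomial.totalDegree_pow _ _).trans ?_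
      rw [pow_succ]; nlinarith
    · refine (MvPolynomial.totalDegree_mul _ _).trans ?_
      rw [MvPolynomial.totalDegree_C, zero_add]
      refine (MvPolynomial.totalDegree_pow _ _).trans ?_
      rw [pow_succ]; nlinarith

lemma smooth_zero (x : ℂ) (h : ‖x‖ ≤ 1/8) (j : ℕ) : ‖smooth x j‖ ≤ 1 / 8 * (1/2) ^ j := by
  induction j with
  | zero => simpa [smooth] using h
  | succ j ih =>
    set y := smooth x j
    have hy : ‖y‖ ≤ 1/8 := ih.trans (by
      have : ((1:ℝ)/2)^j ≤ 1 := pow_le_one₀ (by norm_num) (by norm_num)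
      linarith)
    have e : smooth x (j+1) = y * (y * (3 - 2 * y)) := by simp [smooth, y]; ring
    rw [e, norm_mul, norm_mul]
    have h3 : ‖3 - 2 * y‖ ≤ 4 := by
      refine (norm_sub_le _ _).trans ?_
      rw [norm_mul]; norm_num; linarith
    have : ‖y‖ * ‖3 - 2 * y‖ ≤ 1/8 * 4 := mul_le_mul hy h3 (norm_nonneg _) (by norm_num)
    rw [pow_succ]
    nlinarith [norm_nonneg y]

lemma smooth_symm {R : Type*} [CommRing R] (x : R) (j : ℕ) : smooth (1 - x) j = 1 - smooth x j := by
  induction j with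
  | zero => rfl
  | succ j ih => simp only [smooth, ih]; ring

lemma smooth_one (x : ℂ) (h : ‖1 - x‖ ≤ 1/8) (j : ℕ) : ‖1 - smooth x j‖ ≤ 1 / 8 * (1/2) ^ j := by
  rw [← smooth_symm]; exact smooth_zero _ h j

/-- separation: if polynomials realise all bit patterns approximately then `2^K` is bounded -/
lemma aux_patterns {κ : Type*} [Fintype κ] [DecidableEq κ] [Nonempty κ] (n D : ℕ)
    (Y : κ → MvPolynomial (Fin n) ℂ) (hdeg : ∀ k, (Y k).totalDegree ≤ D)
    (p : (κ → Bool) → Fin n → ℂ)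
    (hp : ∀ σ k, ‖(if σ k then (1:ℂ) else 0) - MvPolynomial.eval (p σ) (Y k)‖ ≤ 1/8) :
    2 ^ (Fintype.card κ) ≤ (4 * Fintype.card κ ^ 3 * D + 1) ^ n := by
  set K := Fintype.card κ with hK
  have hK1 : 1 ≤ K := Fintype.card_pos
  set j := Nat.clog 2 K with hj
  have hj1 : K ≤ 2 ^ j := Nat.le_pow_clog (by norm_num) K
  have hj2 : 2 ^ j ≤ 2 * K := by
    rcases Nat.eq_zero_or_pos j with h | h
    · rw [h]; omega
    · rcases Nat.lt_or_ge 1 K with h1 | h1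
      · have := Nat.pow_pred_clog_lt_self (b := 2) (by norm_num) h1
        rw [← hj] at this
        obtain ⟨i, hi⟩ : ∃ i, j = i + 1 := ⟨j - 1, by omega⟩
        rw [hi] at this ⊢
        simp at this
        rw [pow_succ]; omega
      · have : K = 1 := by omega
        rw [this] at hj
        simp at hj; omega
  have hj3 : 3 ^ j ≤ 4 * K ^ 2 := by
    calc 3 ^ j ≤ 4 ^ j := Nat.pow_le_pow_left (by norm_num) j
      _ = (2 ^ j) ^ 2 := by rw [← pow_mul, mul_comm, pow_mul]; norm_num
      _ ≤ (2 * K) ^ 2 := Nat.pow_le_pow_left hj2 2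
      _ = _ := by ring
  let fac : κ → Bool → MvPolynomial (Fin n) ℂ := fun k c => if c then smooth (Y k) j else 1 - smooth (Y k) j
  let Φ : (κ → Bool) → MvPolynomial (Fin n) ℂ := fun τ => ∏ k, fac k (τ k)
  have hfd : ∀ k c, (fac k c).totalDegree ≤ 3 ^ j * D := by
    intro k c
    have := smooth_deg (Y k) D (hdeg k) j
    cases c
    · simp only [fac, Bool.false_eq_true, if_false]
      refine (MvPolynomial.totalDegree_sub _ _).trans (max_le ?_ this)
      simp
    · simpa [fac] using this
  have hΦd : ∀ τ, (Φ τ).totalDegree ≤ 4 * K ^ 3 * D := by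
    intro τ
    refine (MvPolynomial.totalDegree_finsetProd _ _).trans ?_
    refine (Finset.sum_le_card_nsmul _ _ (3 ^ j * D) fun k _ => hfd k _).trans ?_
    rw [Finset.card_univ, smul_eq_mul, ← hK]
    calc K * (3 ^ j * D) ≤ K * (4 * K ^ 2 * D) := by gcongr
      _ = _ := by ring
  set e : ℝ := 1 / (8 * K) with he
  have hKr : (1:ℝ) ≤ K := by exact_mod_cast hK1
  have he0 : 0 < e := by positivity
  have he8 : e ≤ 1/8 := by
    rw [he]; apply one_div_le_one_div_of_le <;> linarith
  have hej : 1 / 8 * ((1:ℝ)/2) ^ j ≤ e := by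
    have : (K:ℝ) ≤ 2 ^ j := by exact_mod_cast hj1
    rw [he, one_div_pow, ← one_div_mul_one_div]
    gcongr
  have hmis : ∀ σ k, ‖MvPolynomial.eval (p σ) (fac k (!σ k))‖ ≤ e := by
    intro σ k
    have h := hp σ k
    cases hσ : σ k
    · simp only [hσ, Bool.false_eq_true, if_false, zero_sub, norm_neg] at h
      simp only [fac, Bool.not_false, if_true, smooth_map]
      exact (smooth_zero _ h j).trans hej
    · simp only [hσ, if_true] at h
      simp only [fac, Bool.not_true, Bool.false_eq_true, if_false, map_sub, map_one, smooth_map]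
      exact (smooth_one _ h j).trans hej
  have hsum : ∀ k, fac k true + fac k false = 1 := by
    intro k; simp [fac]
  have hmat : ∀ σ k, 1 - e ≤ ‖MvPolynomial.eval (p σ) (fac k (σ k))‖ := by
    intro σ k
    have h1 : MvPolynomial.eval (p σ) (fac k (σ k)) = 1 - MvPolynomial.eval (p σ) (fac k (!σ k)) := by
      have := congrArg (MvPolynomial.eval (p σ)) (hsum k)
      rw [map_add, map_one] at this
      cases hσ : σ k
      · simp only [Bool.not_false]; rw [← this]; ring
      · simp only [Bool.not_true]; rw [← this]; ring
    rw [h1]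
    have := norm_sub_norm_le (1:ℂ) (MvPolynomial.eval (p σ) (fac k (!σ k)))
    rw [norm_one] at this
    have := hmis σ k
    linarith
  have main := aux_rank (S := κ → Bool) n (4 * K ^ 3 * D) p Φ hΦd ?_
  · simpa using main
  · intro σ
    have htot : ∑ τ, ‖MvPolynomial.eval (p σ) (Φ τ)‖
        = ∏ k, ∑ c : Bool, ‖MvPolynomial.eval (p σ) (fac k c)‖ := by
      rw [Finset.prod_univ_sum]
      simp only [Fintype.piFinset_univ, Φ, map_prod, norm_prod]
    have hle : ∏ k, ∑ c : Bool, ‖MvPolynomial.eval (p σ) (fac k c)‖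
        ≤ ∏ k, (1 + 2 * e) * ‖MvPolynomial.eval (p σ) (fac k (σ k))‖ := by
      refine Finset.prod_le_prod (fun k _ => Finset.sum_nonneg fun _ _ => norm_nonneg _) fun k _ => ?_
      have h1 := hmis σ k
      have h2 := hmat σ k
      have h3 : ∑ c : Bool, ‖MvPolynomial.eval (p σ) (fac k c)‖
        = ‖MvPolynomial.eval (p σ) (fac k (σ k))‖ + ‖MvPolynomial.eval (p σ) (fac k (!σ k))‖ := by
        cases σ k <;> simp [add_comm]
      rw [h3]
      nlinarith
    rw [Finset.prod_mul_distrib, Finset.prod_const, Finset.card_univ, ← hK] at hle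
    have hexp : (1 + 2 * e) ^ K < 2 := by
      have h1 : (1 + 2 * e) ^ K ≤ Real.exp (2 * e) ^ K :=
        pow_le_pow_left₀ (by positivity) (by linarith [Real.add_one_le_exp (2 * e)]) K
      rw [← Real.exp_nat_mul] at h1
      have h2 : (K:ℝ) * (2 * e) = 1/4 := by rw [he]; field_simp; norm_num
      rw [h2] at h1
      have h3 : Real.exp (1/4) < 2 := by
        have h5 := Real.exp_one_lt_d9
        have h6 : Real.exp (1/4) ^ 4 = Real.exp 1 := by
          rw [← Real.exp_nat_mul]; norm_num
        by_contra hcon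
        push Not at hcon
        have := pow_le_pow_left₀ (by norm_num) hcon 4
        rw [h6] at this
        norm_num at this
        linarith
      linarith
    have hpos : 0 < ∏ k, ‖MvPolynomial.eval (p σ) (fac k (σ k))‖ :=
      Finset.prod_pos fun k _ => by
        have := hmat σ k
        linarith
    have hΦσ : ‖MvPolynomial.eval (p σ) (Φ σ)‖ = ∏ k, ‖MvPolynomial.eval (p σ) (fac k (σ k))‖ := by
      simp only [Φ, map_prod, norm_prod]
    have hsplit := Finset.add_sum_erase Finset.univ (fun τ => ‖MvPolynomial.eval (p σ) (Φ τ)‖) (Finset.mem_univ σ)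
    rw [htot] at hsplit
    rw [hΦσ] at hsplit ⊢
    nlinarith

lemma aux_choose (lam a1 a2 E : ℝ) (q : ℕ) (hl : 0 < lam) :
    ∃ c : ℕ, 1 ≤ c ∧ a1 + a2 * Real.log c ≤ lam * c ∧
      E * (c:ℝ) ^ 4 * 2 ^ (q + 7) < (2:ℝ) ^ ((c:ℝ) * Real.log 2) := by
  have hlog2 : 0 < Real.log 2 := Real.log_pos (by norm_num)
  have h1 : ∀ᶠ x : ℝ in Filter.atTop, a1 + a2 * Real.log x ≤ lam * x := by
    have h := (Real.isLittleO_log_id_atTop.const_mul_left a2).add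
      (Asymptotics.isLittleO_const_id_atTop a1)
    filter_upwards [h.bound hl, Filter.eventually_ge_atTop 0] with x hx hx0
    rw [id, Real.norm_of_nonneg hx0] at hx
    linarith [Real.le_norm_self (a2 * Real.log x + a1)]
  have h2 : ∀ᶠ x : ℝ in Filter.atTop, E * x ^ 4 * 2 ^ (q + 7) < (2:ℝ) ^ (x * Real.log 2) := by
    have h := (isLittleO_pow_exp_pos_mul_atTop 4 (b := Real.log 2 * Real.log 2) (by positivity)).const_mul_left
      (E * 2 ^ (q+7))
    filter_upwards [h.bound (show (0:ℝ) < 1/2 by norm_num)] with x hx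
    rw [Real.norm_of_nonneg (Real.exp_pos _).le] at hx
    rw [Real.rpow_def_of_pos (by norm_num)]
    have := Real.exp_pos (Real.log 2 * Real.log 2 * x)
    have h3 := Real.le_norm_self (E * 2 ^ (q+7) * x ^ 4)
    have e : Real.log 2 * (x * Real.log 2) = Real.log 2 * Real.log 2 * x := by ring
    rw [e]
    linarith
  have h3 := tendsto_natCast_atTop_atTop (R := ℝ) |>.eventually (h1.and h2)
  obtain ⟨c, hc, hc1⟩ := (h3.and (Filter.eventually_ge_atTop 1)).exists
  exact ⟨c, hc1, hc⟩

set_option maxHeartbeats 1600000 in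
lemma aux_num (s : ℕ) (hs : 1 ≤ s) (l Q r c₀ : ℝ) (q : ℕ) (hq : 2 ≤ q) (hl : 0 < l)
    (hr : 0 < r) (hr1 : r < 1) (hc₀ : 0 < c₀) :
    ∃ c : ℕ, 1 ≤ c ∧ ∀ n : ℕ, 2 ≤ n → ∃ G : ℕ, 1 ≤ G ∧
      (G:ℝ) ≤ 2 * ((c:ℝ) * (n * Real.log n)) ^ (1 / (s:ℝ)) ∧
      (n:ℝ) * ((c * n ^ q : ℕ):ℝ) ^ n * ((1 + ((c * n ^ q : ℕ):ℝ)) *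
        (Real.exp (Q * n ^ q) * r ^ (c * n ^ q) / (1 - r))) ≤ c₀ * (G:ℝ) ^ (-l) / 8 ∧
      (4 * (G ^ s) ^ 3 * (n * (c * n ^ q)) + 1) ^ n < 2 ^ (G ^ s) := by
  set lam := - Real.log r with hlam
  have hlam0 : 0 < lam := by have := Real.log_neg hr hr1; linarith
  have h1r : 0 < 1 - r := by linarith
  set k := |Real.log (8 / (c₀ * (1 - r)))| with hk
  obtain ⟨c, hc1, hca, hcb⟩ := aux_choose lam (1 + q + (1 + q) + l * 3 + Q + k) (2 + l)
    (5 * 8 ^ s) q hlam0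
  refine ⟨c, hc1, fun n hn => ?_⟩
  have hcr : (1:ℝ) ≤ c := by exact_mod_cast hc1
  have hnr : (2:ℝ) ≤ n := by exact_mod_cast hn
  have hlogc : 0 ≤ Real.log c := Real.log_nonneg hcr
  have hlogn1 : Real.log n ≤ n := (Real.log_le_sub_one_of_pos (by linarith)).trans (by linarith)
  have hlog2 : 0.69 < Real.log 2 := by linarith [Real.log_two_gt_d9]
  have hlogn2 : Real.log 2 ≤ Real.log n := Real.log_le_log (by norm_num) hnr
  set T := (c:ℝ) * (n * Real.log n) with hT
  have hT1 : 1 ≤ T := by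
    have : 1 ≤ (n:ℝ) * Real.log n := by nlinarith
    nlinarith
  have hTle : T ≤ c * (n:ℝ) ^ 2 := by
    rw [hT, pow_two]; gcongr
  have hsr : (1:ℝ) ≤ s := by exact_mod_cast hs
  have hTs1 : 1 ≤ T ^ (1 / (s:ℝ)) := Real.one_le_rpow hT1 (by positivity)
  have hTs2 : T ^ (1 / (s:ℝ)) ≤ T := by
    have : 1 / (s:ℝ) ≤ 1 := by rw [div_le_one (by linarith)]; exact hsr
    simpa using Real.rpow_le_rpow_of_exponent_le hT1 this
  have hTss : (T ^ (1 / (s:ℝ))) ^ s = T := by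
    rw [one_div]
    exact Real.rpow_inv_natCast_pow (by linarith) (by omega)
  set G := ⌈T ^ (1 / (s:ℝ))⌉₊ with hG
  have hG1 : T ^ (1 / (s:ℝ)) ≤ G := Nat.le_ceil _
  have hG2 : (G:ℝ) ≤ 2 * T ^ (1 / (s:ℝ)) := by
    have := (Nat.ceil_lt_add_one (show 0 ≤ T ^ (1 / (s:ℝ)) by linarith)).le
    linarith
  have hGr1 : (1:ℝ) ≤ G := hTs1.trans hG1
  have hG0 : (0:ℝ) < G := by linarith
  refine ⟨G, by exact_mod_cast hGr1, hG2, ?_, ?_⟩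
  · set X : ℝ := (n:ℝ) ^ q with hX
    have hXn2 : (n:ℝ) ^ 2 ≤ X := pow_le_pow_right₀ (by linarith) hq
    have hn2 : (n:ℝ) ≤ (n:ℝ) ^ 2 := by nlinarith
    have hX1 : 1 ≤ X := by linarith
    have hXn : (n:ℝ) ≤ X := by linarith
    have hL : ((c * n ^ q : ℕ) : ℝ) = c * X := by push_cast; rfl
    rw [hL]
    have hcX : 1 ≤ c * X := by nlinarith
    have hcX_le : c * X ≤ Real.exp (Real.log c + q * n) := by
      rw [Real.exp_add, Real.exp_log (by linarith), mul_comm (q:ℝ), Real.exp_mul, Real.rpow_natCast, hX]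
      gcongr
      linarith [Real.add_one_le_exp (n:ℝ)]
    have b1 : (n:ℝ) ≤ Real.exp X := by linarith [Real.add_one_le_exp X]
    have b2 : (c * X) ^ n ≤ Real.exp ((Real.log c + q) * X) := by
      calc (c * X) ^ n ≤ (Real.exp (Real.log c + q * n)) ^ n := by gcongr
        _ = Real.exp (n * (Real.log c + q * n)) := by rw [← Real.exp_nat_mul]
        _ ≤ _ := by
          apply Real.exp_le_exp.2
          have : (q:ℝ) * (n:ℝ)^2 ≤ q * X := by gcongr
          have : Real.log c * (n:ℝ) ≤ Real.log c * X := by gcongr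
          nlinarith
    have b3 : 1 + c * X ≤ Real.exp ((1 + Real.log c + q) * X) := by
      calc 1 + c * X ≤ 2 * (c * X) := by linarith
        _ ≤ Real.exp 1 * Real.exp (Real.log c + q * n) := by
          gcongr
          linarith [Real.add_one_le_exp (1:ℝ)]
        _ = Real.exp (1 + (Real.log c + q * n)) := by rw [← Real.exp_add]
        _ ≤ _ := by
          apply Real.exp_le_exp.2
          have : (q:ℝ) * (n:ℝ) ≤ q * X := by gcongr
          have : Real.log c * 1 ≤ Real.log c * X := by gcongr
          nlinarith
    have b4 : (G:ℝ) ^ l ≤ Real.exp (l * (3 + Real.log c) * X) := by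
      have : (G:ℝ) ≤ Real.exp ((3 + Real.log c) * X) := by
        calc (G:ℝ) ≤ 2 * (c * (n:ℝ) ^ 2) := by linarith
          _ ≤ Real.exp 1 * (Real.exp (Real.log c) * Real.exp (2 * n)) := by
            rw [Real.exp_log (by linarith), mul_comm (2:ℝ) (n:ℝ), Real.exp_mul (n:ℝ) 2]
            have e : Real.exp (n:ℝ) ^ (2:ℝ) = Real.exp (n:ℝ) ^ (2:ℕ) := by
              rw [← Real.rpow_natCast]; norm_num
            rw [e]
            gcongr
            · linarith [Real.add_one_le_exp (1:ℝ)]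
            · linarith [Real.add_one_le_exp (n:ℝ)]
          _ = Real.exp (1 + (Real.log c + 2 * n)) := by rw [← Real.exp_add, ← Real.exp_add]
          _ ≤ _ := by
            apply Real.exp_le_exp.2
            have : Real.log c * 1 ≤ Real.log c * X := by gcongr
            nlinarith
      calc (G:ℝ) ^ l ≤ (Real.exp ((3 + Real.log c) * X)) ^ l := by gcongr
        _ = _ := by rw [← Real.exp_mul]; ring_nf
    have b5 : 8 / (c₀ * (1 - r)) ≤ Real.exp (k * X) := by
      calc _ = Real.exp (Real.log (8 / (c₀ * (1 - r)))) := (Real.exp_log (by positivity)).symm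
        _ ≤ _ := by
          apply Real.exp_le_exp.2
          have h1 := le_abs_self (Real.log (8 / (c₀ * (1 - r))))
          have h2 : k * 1 ≤ k * X := by gcongr
          linarith
    have b6 : r ^ (c * n ^ q) = Real.exp (-(lam * c * X)) := by
      rw [← Real.rpow_natCast, Real.rpow_def_of_pos hr, hL, hlam]; ring_nf
    rw [b6]
    have hGl : 0 < (G:ℝ) ^ l := by positivity
    rw [Real.rpow_neg hG0.le]
    have main : (n:ℝ) * (c * X) ^ n * ((1 + c * X) * (Real.exp (Q * X) * Real.exp (-(lam * c * X))))
        * (8 / (c₀ * (1 - r))) * (G:ℝ) ^ l ≤ 1 := by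
      calc _ ≤ Real.exp X * Real.exp ((Real.log c + q) * X) * (Real.exp ((1 + Real.log c + q) * X)
            * (Real.exp (Q * X) * Real.exp (-(lam * c * X)))) * Real.exp (k * X)
            * Real.exp (l * (3 + Real.log c) * X) := by
            gcongr
        _ = Real.exp ((1 + (Real.log c + q) + (1 + Real.log c + q) + Q - lam * c + k + l * (3 + Real.log c)) * X) := by
            simp only [← Real.exp_add]; congr 1; ring
        _ ≤ 1 := by
            rw [Real.exp_le_one_iff]
            apply mul_nonpos_of_nonpos_of_nonneg _ (by linarith)
            nlinarith
    have e1 : (n:ℝ) * (c * X) ^ n * ((1 + c * X) * (Real.exp (Q * X) * Real.exp (-(lam * c * X)) / (1 - r)))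
      = ((n:ℝ) * (c * X) ^ n * ((1 + c * X) * (Real.exp (Q * X) * Real.exp (-(lam * c * X))))
        * (8 / (c₀ * (1 - r))) * (G:ℝ) ^ l) * (c₀ * ((G:ℝ) ^ l)⁻¹ / 8) := by
      field_simp
    rw [e1]
    exact mul_le_of_le_one_left (by positivity) main
  · have hKge : T ≤ (G:ℝ) ^ s := by
      rw [← hTss]; gcongr
    have hKle : (G:ℝ) ^ s ≤ 2 ^ s * (c * (n:ℝ) ^ 2) := by
      calc (G:ℝ) ^ s ≤ (2 * T ^ (1 / (s:ℝ))) ^ s := by gcongr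
        _ = 2 ^ s * T := by rw [mul_pow, hTss]
        _ ≤ _ := by gcongr
    have hn0 : (0:ℝ) < n := by linarith
    have hbase : (4 * ((G:ℝ) ^ s) ^ 3 * (n * (c * (n:ℝ) ^ q)) + 1) < (n:ℝ) ^ ((c:ℝ) * Real.log 2) := by
      have h1 : 4 * ((G:ℝ) ^ s) ^ 3 * (n * (c * (n:ℝ) ^ q)) ≤ 4 * 8 ^ s * (c:ℝ) ^ 4 * (n:ℝ) ^ (q+7) := by
        calc _ ≤ 4 * (2 ^ s * (c * (n:ℝ) ^ 2)) ^ 3 * (n * (c * (n:ℝ) ^ q)) := by gcongr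
          _ = 4 * ((2:ℝ) ^ s) ^ 3 * (c:ℝ) ^ 4 * (n:ℝ) ^ (q+7) := by ring
          _ = _ := by
            have : ((2:ℝ) ^ s) ^ 3 = 8 ^ s := by
              rw [← pow_mul, mul_comm, pow_mul]; norm_num
            rw [this]
      have h2 : 1 ≤ 8 ^ s * (c:ℝ) ^ 4 * (n:ℝ) ^ (q+7) := by
        have a : (1:ℝ) ≤ 8 ^ s := one_le_pow₀ (by norm_num)
        have b : (1:ℝ) ≤ (c:ℝ) ^ 4 := one_le_pow₀ hcr
        have d : (1:ℝ) ≤ (n:ℝ) ^ (q+7) := one_le_pow₀ (by linarith)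
        exact one_le_mul_of_one_le_of_one_le (one_le_mul_of_one_le_of_one_le a b) d
      have hE1 : (1:ℝ) ≤ 5 * 8 ^ s * (c:ℝ) ^ 4 := by
        have a : (1:ℝ) ≤ 8 ^ s := one_le_pow₀ (by norm_num)
        have b : (1:ℝ) ≤ (c:ℝ) ^ 4 := one_le_pow₀ hcr
        exact one_le_mul_of_one_le_of_one_le (by linarith) b
      set w := (c:ℝ) * Real.log 2 - ((q + 7 : ℕ):ℝ) with hw
      have h3 : 5 * 8 ^ s * (c:ℝ) ^ 4 < (2:ℝ) ^ w := by
        rw [hw, Real.rpow_sub (by norm_num), Real.rpow_natCast, lt_div_iff₀ (by positivity)]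
        exact hcb
      have hw0 : 0 ≤ w := by
        by_contra hcon
        push Not at hcon
        have := Real.rpow_lt_one_of_one_lt_of_neg (show (1:ℝ) < 2 by norm_num) hcon
        linarith
      have h4 : (2:ℝ) ^ w ≤ (n:ℝ) ^ w := by gcongr
      calc _ ≤ 5 * 8 ^ s * (c:ℝ) ^ 4 * (n:ℝ) ^ (q+7) := by linarith
        _ < (n:ℝ) ^ w * (n:ℝ) ^ (q+7) := by
          gcongr; linarith
        _ = _ := by
          rw [← Real.rpow_natCast, ← Real.rpow_add hn0, hw]; congr 1; ring
    have hfin : (4 * ((G:ℝ) ^ s) ^ 3 * (n * (c * (n:ℝ) ^ q)) + 1) ^ n < 2 ^ (G ^ s) := by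
      calc _ < ((n:ℝ) ^ ((c:ℝ) * Real.log 2)) ^ n := by
            gcongr
        _ = (2:ℝ) ^ T := by
          rw [← Real.rpow_mul_natCast hn0.le, Real.rpow_def_of_pos hn0, Real.rpow_def_of_pos (by norm_num), hT]
          congr 1; ring
        _ ≤ (2:ℝ) ^ ((G ^ s : ℕ) : ℝ) := by
          apply Real.rpow_le_rpow_of_exponent_le (by norm_num)
          push_cast; exact hKge
        _ = _ := by rw [Real.rpow_natCast]
    exact_mod_cast hfin

lemma cube_unique (s : ℕ) : UniqueDiffOn ℝ (cube s) := by
  apply uniqueDiffOn_convex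
  · intro x hx y hy a b ha hb hab i
    have := (convex_Icc (0:ℝ) 1) (hx i) (hy i) ha hb hab
    simpa using this
  · refine ⟨WithLp.toLp 2 fun _ => 1/2, ?_⟩
    rw [mem_interior]
    refine ⟨Metric.ball (WithLp.toLp 2 fun _ => 1/2) (1/2), ?_, Metric.isOpen_ball,
      Metric.mem_ball_self (by norm_num)⟩
    intro x hx i
    rw [mem_ball_iff_norm] at hx
    have h1 := (PiLp.norm_apply_le (x - WithLp.toLp 2 fun _ => 1/2) i).trans hx.le
    simp only [PiLp.sub_apply, Real.norm_eq_abs] at h1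
    rw [abs_le] at h1
    constructor <;> linarith [h1.1, h1.2]

def bumpc {s G : ℕ} (κ : Fin s → Fin G) : EuclideanSpace ℝ (Fin s) :=
  WithLp.toLp 2 fun i => ((κ i : ℕ) : ℝ) + 1/2

lemma bumpc_sep {s G : ℕ} (κ κ' : Fin s → Fin G) (y : EuclideanSpace ℝ (Fin s))
    (h : ‖y - bumpc κ‖ ≤ 1/4) (h' : ‖y - bumpc κ'‖ ≤ 1/4) : κ = κ' := by
  funext i
  have h1 := (PiLp.norm_apply_le _ i).trans h
  have h2 := (PiLp.norm_apply_le _ i).trans h'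
  simp only [bumpc, PiLp.sub_apply, Real.norm_eq_abs] at h1 h2
  rw [abs_le] at h1 h2
  have h3 : ((κ i : ℕ) : ℝ) < (κ' i : ℕ) + 1 := by linarith [h1.1, h2.2]
  have h4 : ((κ' i : ℕ) : ℝ) < (κ i : ℕ) + 1 := by linarith [h1.2, h2.1]
  have h3' : (κ i : ℕ) < (κ' i : ℕ) + 1 := by exact_mod_cast h3
  have h4' : (κ' i : ℕ) < (κ i : ℕ) + 1 := by exact_mod_cast h4
  ext; omega

lemma aux_bumps (s m : ℕ) : ∃ B : ℝ, 1 ≤ B ∧ ∀ G : ℕ, ∀ σ : (Fin s → Fin G) → Bool,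
    ∃ Ψ : EuclideanSpace ℝ (Fin s) → ℝ, ContDiff ℝ (m + 1 : ℕ) Ψ ∧
      (∀ j ≤ m + 1, ∀ y, ‖iteratedFDeriv ℝ j Ψ y‖ ≤ B) ∧
      ∀ κ, Ψ (bumpc κ) = if σ κ then 1 else 0 := by
  let ψ : ContDiffBump (0 : EuclideanSpace ℝ (Fin s)) := ⟨1/8, 1/4, by norm_num, by norm_num⟩
  have hψ : ∀ k : ℕ, ContDiff ℝ k ψ := fun k => ψ.contDiff
  have hex : ∀ j : ℕ, ∃ C, ∀ y, ‖iteratedFDeriv ℝ j ψ y‖ ≤ C := fun j =>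
    ((hψ j).continuous_iteratedFDeriv le_rfl).bounded_above_of_compact_support
      (ψ.hasCompactSupport.iteratedFDeriv j)
  choose C hC using hex
  have hC0 : ∀ j, 0 ≤ C j := fun j => (norm_nonneg _).trans (hC j 0)
  refine ⟨1 + ∑ j ∈ Finset.range (m + 2), C j, ?_, ?_⟩
  · have := Finset.sum_nonneg fun j (_ : j ∈ Finset.range (m+2)) => hC0 j
    linarith
  intro G σ
  have hterm : ∀ (k : ℕ) (κ : Fin s → Fin G), ContDiff ℝ k
      (fun y : EuclideanSpace ℝ (Fin s) => (if σ κ then (1:ℝ) else 0) • ψ (y + -bumpc κ)) := by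
    intro k κ
    exact ContDiff.const_smul _ ((hψ k).comp (contDiff_id.add contDiff_const))
  have hcomp : ∀ (k : ℕ) (κ : Fin s → Fin G), ContDiff ℝ k
      (fun y : EuclideanSpace ℝ (Fin s) => ψ (y + -bumpc κ)) := by
    intro k κ
    exact ((hψ k).comp (contDiff_id.add contDiff_const))
  have hz : ∀ (j : ℕ) (y : EuclideanSpace ℝ (Fin s)), ¬ ‖y‖ ≤ 1/4 → iteratedFDeriv ℝ j ψ y = 0 := by
    intro j y hy
    by_contra hne
    have := support_iteratedFDeriv_subset (𝕜 := ℝ) (f := ψ) j (Function.mem_support.2 hne)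
    rw [ψ.tsupport_eq, mem_closedBall_zero_iff] at this
    exact hy this
  refine ⟨fun y => ∑ κ, (if σ κ then (1:ℝ) else 0) • ψ (y + -bumpc κ), ?_, ?_, ?_⟩
  · exact ContDiff.sum fun κ _ => hterm _ κ
  · intro j hj y
    have hle : C j ≤ 1 + ∑ j ∈ Finset.range (m + 2), C j := by
      have := Finset.single_le_sum (fun j (_ : j ∈ Finset.range (m+2)) => hC0 j)
        (Finset.mem_range.2 (by omega : j < m + 2))
      linarith
    refine le_trans ?_ hle
    rw [iteratedFDeriv_fun_sum_apply fun κ _ => (hterm j κ).contDiffAt]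
    have e : ∀ κ : Fin s → Fin G, iteratedFDeriv ℝ j
        (fun y : EuclideanSpace ℝ (Fin s) => (if σ κ then (1:ℝ) else 0) • ψ (y + -bumpc κ)) y
        = (if σ κ then (1:ℝ) else 0) • iteratedFDeriv ℝ j ψ (y + -bumpc κ) := by
      intro κ
      rw [iteratedFDeriv_const_smul_apply' (hcomp j κ).contDiffAt, iteratedFDeriv_comp_add_right]
    simp only [e]
    by_cases hκ : ∃ κ : Fin s → Fin G, ‖y - bumpc κ‖ ≤ 1/4
    · obtain ⟨κ, hκ⟩ := hκ
      rw [Finset.sum_eq_single κ]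
      · rw [norm_smul]
        have h1 : ‖(if σ κ then (1:ℝ) else 0)‖ ≤ 1 := by split_ifs <;> simp
        calc _ ≤ 1 * C j := mul_le_mul h1 (hC j _) (norm_nonneg _) zero_le_one
          _ = _ := one_mul _
      · intro κ' _ hne
        rw [hz, smul_zero]
        intro hcon
        rw [← sub_eq_add_neg] at hcon
        exact hne (bumpc_sep _ _ y hcon hκ)
      · intro h; exact absurd (Finset.mem_univ κ) h
    · push Not at hκ
      rw [Finset.sum_eq_zero]
      · simpa using hC0 j
      · intro κ _
        rw [hz, smul_zero]
        rw [← sub_eq_add_neg]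
        exact not_le.2 (hκ κ)
  · intro κ
    simp only
    rw [Finset.sum_eq_single κ]
    · have : ψ (bumpc κ + -bumpc κ) = 1 := by
        rw [add_neg_cancel]
        exact ψ.one_of_mem_closedBall (Metric.mem_closedBall_self ψ.rIn_pos.le)
      rw [this]; simp
    · intro κ' _ hne
      have : ψ (bumpc κ + -bumpc κ') = 0 := by
        apply ψ.zero_of_le_dist
        rw [dist_zero_right, ← sub_eq_add_neg]
        by_contra hcon
        push Not at hcon
        exact hne (bumpc_sep κ' κ (bumpc κ) hcon.le (by simp))
      rw [this, smul_zero]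
    · intro h; exact absurd (Finset.mem_univ κ) h

lemma aux_holder (s m : ℕ) (α : ℝ) (hα0 : 0 < α) (hα1 : α ≤ 1) :
    ∃ c₀ : ℝ, 0 < c₀ ∧ c₀ ≤ 1 ∧ ∀ G : ℕ, 1 ≤ G → ∃ x : (Fin s → Fin G) → EuclideanSpace ℝ (Fin s),
      (∀ κ, x κ ∈ cube s) ∧ ∀ σ : (Fin s → Fin G) → Bool,
        ∃ h : EuclideanSpace ℝ (Fin s) → ℝ, HolderClass s m α h ∧
          ∀ κ, h (x κ) = c₀ * (G:ℝ) ^ (-((m:ℝ) + α)) * (if σ κ then 1 else 0) := by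
  obtain ⟨B, hB1, hB⟩ := aux_bumps s m
  refine ⟨1 / (2 * B), by positivity, ?_, ?_⟩
  · rw [div_le_one (by positivity)]; linarith
  intro G hG
  have hGr : (1:ℝ) ≤ G := by exact_mod_cast hG
  have hG0 : (0:ℝ) < G := by linarith
  refine ⟨fun κ => (G:ℝ)⁻¹ • bumpc κ, ?_, ?_⟩
  · intro κ i
    have h1 : ((κ i : ℕ) : ℝ) + 1 ≤ G := by exact_mod_cast (κ i).2
    have h0 : (0:ℝ) ≤ ((κ i : ℕ) : ℝ) := by positivity
    simp only [bumpc, PiLp.smul_apply, smul_eq_mul]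
    constructor
    · positivity
    · rw [inv_mul_le_iff₀ hG0]; linarith
  intro σ
  obtain ⟨Ψ, hΨ1, hΨ2, hΨ3⟩ := hB G σ
  set δ := 1 / (2 * B) * (G:ℝ) ^ (-((m:ℝ) + α)) with hδ
  have hδ0 : 0 < δ := by positivity
  have hc1 : ContDiff ℝ (m+1 : ℕ) fun x : EuclideanSpace ℝ (Fin s) => Ψ ((G:ℝ) • x) :=
    hΨ1.comp (contDiff_id.const_smul (G:ℝ))
  have hc2 : ContDiff ℝ (m+1 : ℕ) fun x : EuclideanSpace ℝ (Fin s) => δ • Ψ ((G:ℝ) • x) :=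
    hc1.const_smul δ
  have hle : ∀ j ≤ m, ((j : ℕ) : WithTop ℕ∞) ≤ ((m + 1 : ℕ) : WithTop ℕ∞) := fun j hj => by
    exact_mod_cast (by omega : j ≤ m + 1)
  have hder : ∀ j ≤ m, ∀ x ∈ cube s, iteratedFDerivWithin ℝ j
      (fun x : EuclideanSpace ℝ (Fin s) => δ • Ψ ((G:ℝ) • x)) (cube s) x
      = δ • ((G:ℝ) ^ j • iteratedFDeriv ℝ j Ψ ((G:ℝ) • x)) := by
    intro j hj x hx
    rw [iteratedFDerivWithin_eq_iteratedFDeriv (cube_unique s) (hc2.of_le (hle j hj)).contDiffAt hx,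
      iteratedFDeriv_const_smul_apply' (hc1.of_le (hle j hj)).contDiffAt,
      iteratedFDeriv_comp_const_smul _ (hΨ1.of_le (hle j hj))]
  refine ⟨fun x => δ • Ψ ((G:ℝ) • x), ⟨(hc2.of_le (hle m le_rfl)).contDiffOn, ?_, ?_⟩, ?_⟩
  · intro j hj x hx
    rw [hder j hj x hx, norm_smul, norm_smul, Real.norm_of_nonneg hδ0.le,
      Real.norm_of_nonneg (by positivity)]
    have h1 := hΨ2 j (by omega) ((G:ℝ) • x)
    have h2 : (G:ℝ) ^ (-((m:ℝ) + α)) * (G:ℝ) ^ j ≤ 1 := by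
      rw [← Real.rpow_natCast, ← Real.rpow_add hG0]
      apply Real.rpow_le_one_of_one_le_of_nonpos hGr
      have : (j:ℝ) ≤ m := by exact_mod_cast hj
      linarith
    calc δ * ((G:ℝ) ^ j * ‖iteratedFDeriv ℝ j Ψ ((G:ℝ) • x)‖)
        ≤ δ * ((G:ℝ) ^ j * B) := by gcongr
      _ = 1 / 2 * ((G:ℝ) ^ (-((m:ℝ) + α)) * (G:ℝ) ^ j) := by rw [hδ]; field_simp
      _ ≤ 1 := by linarith
  · intro x hx y hy
    rw [hder m le_rfl x hx, hder m le_rfl y hy, ← smul_sub, ← smul_sub, norm_smul, norm_smul,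
      Real.norm_of_nonneg hδ0.le, Real.norm_of_nonneg (by positivity)]
    set X := (G:ℝ) • x
    set Y := (G:ℝ) • y
    have hXY : ‖X - Y‖ = G * ‖x - y‖ := by
      simp only [X, Y]
      rw [← smul_sub, norm_smul, Real.norm_of_nonneg hG0.le]
    have hlip : ‖iteratedFDeriv ℝ m Ψ X - iteratedFDeriv ℝ m Ψ Y‖ ≤ B * ‖X - Y‖ := by
      refine Convex.norm_image_sub_le_of_norm_fderiv_le (𝕜 := ℝ) (s := univ) ?_ ?_ convex_univ (mem_univ _) (mem_univ _)
      · intro z _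
        exact (hΨ1.differentiable_iteratedFDeriv (by exact_mod_cast Nat.lt_succ_self m)) z
      · intro z _
        rw [norm_fderiv_iteratedFDeriv]
        exact hΨ2 _ le_rfl z
    have hbd : ‖iteratedFDeriv ℝ m Ψ X - iteratedFDeriv ℝ m Ψ Y‖ ≤ 2 * B := by
      refine (norm_sub_le _ _).trans ?_
      linarith [hΨ2 m (by omega) X, hΨ2 m (by omega) Y]
    have hho : ‖iteratedFDeriv ℝ m Ψ X - iteratedFDeriv ℝ m Ψ Y‖ ≤ 2 * B * ‖X - Y‖ ^ α := by
      rcases le_total ‖X - Y‖ 1 with h | h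
      · have : ‖X - Y‖ ≤ ‖X - Y‖ ^ α := by
          rcases (norm_nonneg (X - Y)).eq_or_lt with h0 | h0
          · rw [← h0]; exact Real.rpow_nonneg le_rfl _
          · simpa using Real.rpow_le_rpow_of_exponent_ge h0 h hα1
        have h5 : 0 ≤ ‖X - Y‖ := norm_nonneg _
        nlinarith
      · have : 1 ≤ ‖X - Y‖ ^ α := Real.one_le_rpow h hα0.le
        nlinarith
    rw [hXY, Real.mul_rpow hG0.le (norm_nonneg _)] at hho
    calc _ ≤ δ * ((G:ℝ) ^ m * (2 * B * ((G:ℝ) ^ α * ‖x - y‖ ^ α))) := by gcongr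
      _ = ((G:ℝ) ^ (-((m:ℝ) + α)) * ((G:ℝ) ^ m * (G:ℝ) ^ α)) * ‖x - y‖ ^ α := by
          rw [hδ]; field_simp
      _ = _ := by
          rw [← Real.rpow_natCast, ← Real.rpow_add hG0, ← Real.rpow_add hG0]
          simp
  · intro κ
    have : (G:ℝ) • ((G:ℝ)⁻¹ • bumpc κ) = bumpc κ := by
      rw [smul_smul, mul_inv_cancel₀ hG0.ne', one_smul]
    simp only
    rw [this, hΨ3, smul_eq_mul]

lemma aux_growth (A u v b t d B₁ B₂ r₁ r₂ r n S1 S2 : ℝ) (q : ℕ) (hA : 1 ≤ A) (hu : 1 ≤ u)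
    (hb : 1 ≤ b) (hd : 1 ≤ d) (hB₁ : 1 ≤ B₁) (hB₂ : 1 ≤ B₂) (hr : 0 < r) (hn : 1 ≤ n)
    (hq1 : v ≤ q) (hq2 : t + (r₁ + 1) * d ≤ q) (hq3 : t + (r₂ + 1) * d ≤ q)
    (h10 : 0 ≤ S1) (h20 : 0 ≤ S2) (h1 : S1 ≤ B₁ / r * n ^ (r₁ + 1)) (h2 : S2 ≤ 2 * B₂ * n ^ (r₂ + 1)) :
    A * Real.exp (u * n ^ v) * Real.exp (b * n ^ t * (S1 ^ d + S2 ^ d))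
      ≤ Real.exp ((A + u + b * ((B₁ / r) ^ d + (2 * B₂) ^ d)) * n ^ q) := by
  have hn0 : 0 < n := by linarith
  have hX : 1 ≤ n ^ q := one_le_pow₀ hn
  have hAe : A ≤ Real.exp (A * n ^ q) := by
    have := Real.add_one_le_exp (A * n ^ q)
    nlinarith
  have hpow : ∀ e : ℝ, e ≤ q → n ^ e ≤ n ^ q := by
    intro e he
    rw [← Real.rpow_natCast]
    exact Real.rpow_le_rpow_of_exponent_le hn he
  have e1 : S1 ^ d ≤ (B₁ / r) ^ d * n ^ ((r₁ + 1) * d) := by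
    calc S1 ^ d ≤ (B₁ / r * n ^ (r₁ + 1)) ^ d := by gcongr
      _ = _ := by rw [Real.mul_rpow (by positivity) (by positivity), Real.rpow_mul hn0.le]
  have e2 : S2 ^ d ≤ (2 * B₂) ^ d * n ^ ((r₂ + 1) * d) := by
    calc S2 ^ d ≤ (2 * B₂ * n ^ (r₂ + 1)) ^ d := by gcongr
      _ = _ := by rw [Real.mul_rpow (by positivity) (by positivity), Real.rpow_mul hn0.le]
  have e3 : n ^ t * (S1 ^ d + S2 ^ d) ≤ ((B₁ / r) ^ d + (2 * B₂) ^ d) * n ^ q := by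
    calc n ^ t * (S1 ^ d + S2 ^ d)
        ≤ n ^ t * ((B₁ / r) ^ d * n ^ ((r₁ + 1) * d) + (2 * B₂) ^ d * n ^ ((r₂ + 1) * d)) := by gcongr
      _ = (B₁ / r) ^ d * n ^ (t + (r₁ + 1) * d) + (2 * B₂) ^ d * n ^ (t + (r₂ + 1) * d) := by
          rw [Real.rpow_add hn0, Real.rpow_add hn0]; ring
      _ ≤ (B₁ / r) ^ d * n ^ q + (2 * B₂) ^ d * n ^ q := by
          gcongr
          · exact hpow _ hq2
          · exact hpow _ hq3
      _ = _ := by ring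
  have e4 : b * n ^ t * (S1 ^ d + S2 ^ d) ≤ b * (((B₁ / r) ^ d + (2 * B₂) ^ d) * n ^ q) := by
    rw [mul_assoc]; exact mul_le_mul_of_nonneg_left e3 (by linarith)
  have e5 : u * n ^ v ≤ u * n ^ q := mul_le_mul_of_nonneg_left (hpow _ hq1) (by linarith)
  calc _ ≤ Real.exp (A * n ^ q) * Real.exp (u * n ^ q)
        * Real.exp (b * (((B₁ / r) ^ d + (2 * B₂) ^ d) * n ^ q)) := by
        exact mul_le_mul (mul_le_mul hAe (Real.exp_le_exp.2 e5) (Real.exp_pos _).le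
          (Real.exp_pos _).le) (Real.exp_le_exp.2 e4) (Real.exp_pos _).le (by positivity)
    _ = _ := by rw [← Real.exp_add, ← Real.exp_add]; congr 1; ring

lemma aux_C (s c G : ℕ) (l c₀ X : ℝ) (hl : 0 < l) (hc : 1 ≤ c) (hc₀ : 0 < c₀) (hX : 0 < X)
    (hG1 : 1 ≤ G) (hG : (G:ℝ) ≤ 2 * ((c:ℝ) * X) ^ (1 / (s:ℝ))) :
    c₀ / 16 / (2 * (c:ℝ) ^ (1 / (s:ℝ))) ^ l / X ^ (l / s) ≤ c₀ * (G:ℝ) ^ (-l) / 16 := by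
  have hcr : (0:ℝ) < c := by exact_mod_cast hc
  have hG0 : (0:ℝ) < G := by exact_mod_cast hG1
  have h1 : (G:ℝ) ^ l ≤ (2 * (c:ℝ) ^ (1 / (s:ℝ))) ^ l * X ^ (l / s) := by
    calc (G:ℝ) ^ l ≤ (2 * ((c:ℝ) * X) ^ (1 / (s:ℝ))) ^ l := by gcongr
      _ = ((2 * (c:ℝ) ^ (1 / (s:ℝ))) * X ^ (1 / (s:ℝ))) ^ l := by
        rw [Real.mul_rpow hcr.le hX.le, mul_assoc]
      _ = _ := by
        rw [Real.mul_rpow (by positivity) (by positivity), ← Real.rpow_mul hX.le]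
        congr 2; ring
  rw [Real.rpow_neg hG0.le, div_div]
  have h2 : c₀ * ((G:ℝ) ^ l)⁻¹ / 16 = c₀ / 16 / (G:ℝ) ^ l := by field_simp
  rw [h2]
  gcongr

lemma aux_W {M : ℕ} (a : Fin M → ℝ) (ha : ∀ i, 0 < a i) (z : Fin M → ℂ) (hz : ∀ i, ‖z i‖ < 1) :
    (fun i => (a i : ℂ) * (1 + z i)) ∈ Wset M := by
  intro i
  have h1 := (abs_le.1 (Complex.abs_re_le_norm (z i))).1
  have h2 := hz i
  simp only [Complex.mul_re, Complex.ofReal_re, Complex.ofReal_im, Complex.add_re, Complex.one_re]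
  rw [zero_mul, sub_zero]
  exact mul_pos (ha i) (by linarith)

/-- **Lower bound for approximation by entire families of exponential type.**
For any `f(x,ζ,w)` continuous in `x ∈ I^s`, entire in `ζ ∈ ℂ^N`, holomorphic in `w ∈ W^M`,
with growth `‖f‖ ≤ A e^{u(N+M)^v} e^{b(N+M)^t(‖ζ‖₁^d + ‖w‖₁^d)}`, there are `C > 0`
(depending only on `l, s` and the constants) and `h ∈ Λ_l(I^s)` such that for all
`(ζ,w) ∈ Ω_{N,M}`: `‖h − f(·,ζ,w)‖_∞ ≥ C/((M+N) log(M+N))^{l/s}`. -/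
theorem stmt_3 (s m : ℕ) (hs : 1 ≤ s) (α : ℝ) (hα0 : 0 < α) (hα1 : α ≤ 1)
    (A u v b t d : ℝ) (hA : 1 ≤ A) (hu : 1 ≤ u) (hv : 1 ≤ v) (hb : 1 ≤ b)
    (ht : 1 ≤ t) (hd : 1 ≤ d)
    (B₁ B₂ r₁ r₂ : ℝ) (hB₁ : 1 ≤ B₁) (hB₂ : 1 ≤ B₂) (hr₁ : 1 ≤ r₁) (hr₂ : 1 ≤ r₂)
    (ε : ℝ) (hε0 : 0 < ε) (hε1 : ε < 1) :
    ∃ C : ℝ, 0 < C ∧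
      ∀ N M : ℕ, 2 ≤ N →
      ∀ f : EuclideanSpace ℝ (Fin s) → (Fin N → ℂ) → (Fin M → ℂ) → ℂ,
      (∀ ζ : Fin N → ℂ, ∀ w ∈ Wset M, ContinuousOn (fun x => f x ζ w) (cube s)) →
      (∀ x ∈ cube s, ∀ w ∈ Wset M, AnalyticOnNhd ℂ (fun ζ => f x ζ w) univ) →
      (∀ x ∈ cube s, ∀ ζ : Fin N → ℂ, AnalyticOnNhd ℂ (fun w => f x ζ w) (Wset M)) →
      (∀ ζ : Fin N → ℂ, ∀ w ∈ Wset M, ∀ x ∈ cube s,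
        ‖f x ζ w‖ ≤ A * Real.exp (u * ((N:ℝ) + M) ^ v) *
          Real.exp (b * ((N:ℝ) + M) ^ t * ((∑ j, ‖ζ j‖) ^ d + (∑ i, ‖w i‖) ^ d))) →
      ∀ a : Fin M → ℝ, (∀ i, 0 < a i ∧ a i ≤ B₂ * ((M:ℝ) + N) ^ r₂) →
      ∃ h : EuclideanSpace ℝ (Fin s) → ℝ, HolderClass s m α h ∧
        ∀ (ζ : Fin N → ℝ) (w : Fin M → ℝ),
          (∀ j, |ζ j| ≤ B₁ * ((M:ℝ) + N) ^ r₁) →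
          (∀ i, 0 < w i ∧ |w i - a i| ≤ (1 - ε) * a i) →
          ∃ x ∈ cube s,
            C / (((M:ℝ) + N) * Real.log ((M:ℝ) + N)) ^ (((m:ℝ) + α) / s) ≤
              ‖(h x : ℂ) - f x (fun j => (ζ j : ℂ)) (fun i => (w i : ℂ))‖ := by
  obtain ⟨c₀, hc₀, -, hhol⟩ := aux_holder s m α hα0 hα1
  set l : ℝ := (m:ℝ) + α with hl
  have hl0 : 0 < l := by positivity
  set r := 1 - ε with hr
  have hr0 : 0 < r := by linarith
  have hr1 : r < 1 := by linarith
  obtain ⟨q, hq⟩ := exists_nat_ge (max 2 (max v (max (t + (r₁ + 1) * d) (t + (r₂ + 1) * d))))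
  simp only [max_le_iff] at hq
  obtain ⟨hq0, hq1, hq2, hq3⟩ := hq
  set Q := A + u + b * ((B₁ / r) ^ d + (2 * B₂) ^ d) with hQ
  obtain ⟨c, hc1, hnum⟩ := aux_num s hs l Q r (c₀ / 2) q (by exact_mod_cast hq0) hl0 hr0 hr1 (by positivity)
  have hcr : (0:ℝ) < c := by exact_mod_cast hc1
  refine ⟨c₀ / 16 / (2 * (c:ℝ) ^ (1 / (s:ℝ))) ^ l, by positivity, ?_⟩
  intro N M hN f _ hζ hw hgrow a ha
  obtain ⟨G, hG1, hG2, herr, hcount⟩ := hnum (N + M) (by omega)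
  have hG0 : (0:ℝ) < G := by exact_mod_cast hG1
  obtain ⟨x, hx, hbump⟩ := hhol G hG1
  set n : ℝ := ((N + M : ℕ) : ℝ) with hn
  have hnNM : (N:ℝ) + M = n := by rw [hn]; push_cast; ring
  have hnMN : (M:ℝ) + N = n := by rw [hn]; push_cast; ring
  have hn2 : 2 ≤ n := by rw [hn]; exact_mod_cast (by omega : 2 ≤ N + M)
  have hn0 : 0 < n := by linarith
  rw [hnNM] at hgrow
  rw [hnMN] at ha ⊢
  have hXpos : 0 < n * Real.log n := mul_pos hn0 (Real.log_pos (by linarith))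
  have hCle := aux_C s c G l c₀ (n * Real.log n) hl0 hc1 hc₀ hXpos hG1 hG2
  set δ := c₀ * (G:ℝ) ^ (-l) with hδ
  have hδ0 : 0 < δ := by positivity
  by_contra hcon
  push Not at hcon
  choose h hh1 hh2 using hbump
  choose ζ w hζΩ hwΩ hclose using fun σ => hcon (h σ) (hh1 σ)
  set R := B₁ * n ^ r₁ with hR
  have hR0 : 0 < R := by positivity
  -- the rescaled functions
  let Zm : (Fin (N + M) → ℂ) → Fin N → ℂ := fun z j => ((R / r : ℝ) : ℂ) * z (Fin.castAdd M j)
  let Wm : (Fin (N + M) → ℂ) → Fin M → ℂ := fun z i => (a i : ℂ) * (1 + z (Fin.natAdd N i))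
  have hWm : ∀ z : Fin (N + M) → ℂ, (∀ i, ‖z i‖ < 1) → Wm z ∈ Wset M := fun z hz =>
    aux_W a (fun i => (ha i).1) (fun i => z (Fin.natAdd N i)) (fun i => hz _)
  have hupd : ∀ (z : Fin (N + M) → ℂ) j y, (∀ i, ‖z i‖ < 1) → y ∈ Metric.ball (0:ℂ) 1 →
      ∀ i, ‖Function.update z j y i‖ < 1 := by
    intro z j y hz hy i
    by_cases hij : i = j
    · subst hij; simpa using hy
    · simpa [Function.update_of_ne hij] using hz i
  have hpoly : ∀ κ, ∃ P : MvPolynomial (Fin (N + M)) ℂ, P.totalDegree ≤ (N + M) * (c * (N + M) ^ q) ∧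
      ∀ z, (∀ i, ‖z i‖ ≤ r) → ‖f (x κ) (Zm z) (Wm z) - MvPolynomial.eval z P‖ ≤ δ / 16 := by
    intro κ
    suffices hsuf : _ ∧ _ by
      obtain ⟨P, hP1, hP2⟩ := aux_poly (c * (N + M) ^ q) (Nat.mul_pos hc1 (pow_pos (by omega) q))
        r hr0 hr1 (Real.exp (Q * n ^ q)) (Real.exp_pos _).le (N + M)
        (fun z => f (x κ) (Zm z) (Wm z)) hsuf.1 hsuf.2
      refine ⟨P, hP1, fun z hz => (hP2 z hz).trans (herr.trans (le_of_eq ?_))⟩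
      rw [hδ]; ring
    constructor
    · intro j z hz
      refine Fin.addCases (fun j => ?_) (fun j => ?_) j
      · have e : ∀ y, Wm (Function.update z (Fin.castAdd M j) y) = Wm z := by
          intro y; funext i
          simp only [Wm]
          rw [Function.update_of_ne]
          intro hcon
          have := congrArg Fin.val hcon
          simp at this
          have := j.2; omega
        simp only [e]
        have hA1 : Differentiable ℂ fun ζ => f (x κ) ζ (Wm z) := fun ζ =>
          (hζ (x κ) (hx κ) (Wm z) (hWm z hz) ζ (mem_univ _)).differentiableAt
        have hA2 : Differentiable ℂ fun y => Zm (Function.update z (Fin.castAdd M j) y) := by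
          rw [differentiable_pi]
          intro i
          refine Differentiable.const_mul ?_ _
          have hu : Differentiable ℂ fun y => Function.update z (Fin.castAdd M j) y := fun y =>
            (hasFDerivAt_update z y).differentiableAt
          exact differentiable_pi.1 hu _
        exact (hA1.comp hA2).differentiableOn
      · have e : ∀ y, Zm (Function.update z (Fin.natAdd N j) y) = Zm z := by
          intro y; funext i
          simp only [Zm]
          rw [Function.update_of_ne]
          intro hcon
          have := congrArg Fin.val hcon
          simp at this
          have := i.2; omega
        simp only [e]
        have hA1 : DifferentiableOn ℂ (fun w => f (x κ) (Zm z) w) (Wset M) := fun w' hw' =>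
          (hw (x κ) (hx κ) (Zm z) w' hw').differentiableAt.differentiableWithinAt
        have hA2 : Differentiable ℂ fun y => Wm (Function.update z (Fin.natAdd N j) y) := by
          rw [differentiable_pi]
          intro i
          refine Differentiable.const_mul (Differentiable.const_add _ ?_) _
          have hu : Differentiable ℂ fun y => Function.update z (Fin.natAdd N j) y := fun y =>
            (hasFDerivAt_update z y).differentiableAt
          exact differentiable_pi.1 hu _
        exact hA1.comp hA2.differentiableOn fun y hy => hWm _ (hupd z _ y hz hy)
    · intro z hz
      refine (hgrow (Zm z) (Wm z) (hWm z hz) (x κ) (hx κ)).trans ?_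
      refine aux_growth A u v b t d B₁ B₂ r₁ r₂ r n _ _ q hA hu hb hd hB₁ hB₂ hr0 (by linarith)
        hq1 hq2 hq3 (Finset.sum_nonneg fun _ _ => norm_nonneg _)
        (Finset.sum_nonneg fun _ _ => norm_nonneg _) ?_ ?_
      · have h1 : ∀ j ∈ (Finset.univ : Finset (Fin N)), ‖Zm z j‖ ≤ R / r := by
          intro j _
          simp only [Zm]
          rw [norm_mul, Complex.norm_real, Real.norm_of_nonneg (by positivity)]
          exact mul_le_of_le_one_right (by positivity) (hz _).le
        have h2 := Finset.sum_le_card_nsmul _ _ _ h1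
        rw [Finset.card_univ, Fintype.card_fin, nsmul_eq_mul] at h2
        have h3 : (N:ℝ) ≤ n := by rw [← hnNM]; linarith [(Nat.cast_nonneg M : (0:ℝ) ≤ M)]
        calc _ ≤ (N:ℝ) * (R / r) := h2
          _ ≤ n * (R / r) := by gcongr
          _ = _ := by rw [hR, Real.rpow_add hn0, Real.rpow_one]; ring
      · have h1 : ∀ i ∈ (Finset.univ : Finset (Fin M)), ‖Wm z i‖ ≤ B₂ * n ^ r₂ * 2 := by
          intro i _
          simp only [Wm]
          rw [norm_mul, Complex.norm_real, Real.norm_of_nonneg (ha i).1.le]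
          have h5 : ‖1 + z (Fin.natAdd N i)‖ ≤ 2 := by
            refine (norm_add_le _ _).trans ?_
            rw [norm_one]; linarith [hz (Fin.natAdd N i)]
          exact mul_le_mul (ha i).2 h5 (norm_nonneg _) (by positivity)
        have h2 := Finset.sum_le_card_nsmul _ _ _ h1
        rw [Finset.card_univ, Fintype.card_fin, nsmul_eq_mul] at h2
        have h3 : (M:ℝ) ≤ n := by rw [← hnNM]; linarith [(Nat.cast_nonneg N : (0:ℝ) ≤ N)]
        calc _ ≤ (M:ℝ) * (B₂ * n ^ r₂ * 2) := h2
          _ ≤ n * (B₂ * n ^ r₂ * 2) := by gcongr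
          _ = _ := by rw [Real.rpow_add hn0, Real.rpow_one]; ring
  choose P hP1 hP2 using hpoly
  -- the points
  let p : ((Fin s → Fin G) → Bool) → Fin (N + M) → ℂ := fun σ =>
    Fin.addCases (fun j => ((r / R * ζ σ j : ℝ) : ℂ)) (fun i => ((w σ i / a i - 1 : ℝ) : ℂ))
  have hpr : ∀ σ i, ‖p σ i‖ ≤ r := by
    intro σ i
    refine Fin.addCases (fun j => ?_) (fun j => ?_) i
    · simp only [p, Fin.addCases_left]
      rw [Complex.norm_real, norm_mul, Real.norm_of_nonneg (by positivity), Real.norm_eq_abs]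
      have := hζΩ σ j
      calc _ ≤ r / R * R := by gcongr
        _ = r := by field_simp
    · simp only [p, Fin.addCases_right]
      rw [Complex.norm_real, Real.norm_eq_abs]
      have ha0 := (ha j).1
      have h1 := (hwΩ σ j).2
      have e : w σ j / a j - 1 = (w σ j - a j) / a j := by field_simp
      rw [e, abs_div, abs_of_pos ha0, div_le_iff₀ ha0]
      exact h1
  have hpZ : ∀ σ, Zm (p σ) = fun j => (ζ σ j : ℂ) := by
    intro σ; funext j
    simp only [Zm, p, Fin.addCases_left]
    rw [← Complex.ofReal_mul]
    congr 1
    field_simp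
  have hpW : ∀ σ, Wm (p σ) = fun i => (w σ i : ℂ) := by
    intro σ; funext i
    have ha0 := (ha i).1
    simp only [Wm, p, Fin.addCases_right]
    rw [← Complex.ofReal_one, ← Complex.ofReal_add, ← Complex.ofReal_mul]
    congr 1
    field_simp
    ring
  have : Nonempty (Fin s → Fin G) := ⟨fun _ => ⟨0, hG1⟩⟩
  have hfinal := aux_patterns (κ := Fin s → Fin G) (N + M) ((N + M) * (c * (N + M) ^ q))
    (fun κ => MvPolynomial.C ((1 / δ : ℝ) : ℂ) * P κ) ?_ p ?_
  · rw [Fintype.card_fun, Fintype.card_fin, Fintype.card_fin] at hfinal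
    exact absurd hcount (not_lt.2 hfinal)
  · intro κ
    refine (MvPolynomial.totalDegree_mul _ _).trans ?_
    rw [MvPolynomial.totalDegree_C, zero_add]
    exact hP1 κ
  · intro σ κ
    have h1 := (hclose σ (x κ) (hx κ)).le.trans hCle
    have h2 := hP2 κ (p σ) (hpr σ)
    rw [hpZ, hpW] at h2
    rw [hh2 σ κ] at h1
    rw [map_mul, MvPolynomial.eval_C]
    have hδc : (δ : ℂ) ≠ 0 := by exact_mod_cast hδ0.ne'
    have e : (if σ κ then (1:ℂ) else 0) - ((1 / δ : ℝ) : ℂ) * MvPolynomial.eval (p σ) (P κ)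
        = ((1 / δ : ℝ) : ℂ) * (((δ * (if σ κ then 1 else 0) : ℝ) : ℂ)
          - f (x κ) (fun j => (ζ σ j : ℂ)) (fun i => (w σ i : ℂ))
          + (f (x κ) (fun j => (ζ σ j : ℂ)) (fun i => (w σ i : ℂ)) - MvPolynomial.eval (p σ) (P κ))) := by
      push_cast
      split_ifs <;> field_simp <;> push_cast <;> ring
    rw [e, norm_mul, Complex.norm_real, Real.norm_of_nonneg (by positivity)]
    have h3 := (norm_add_le _ _).trans (add_le_add h1 h2)
    calc _ ≤ 1 / δ * (δ / 16 + δ / 16) := by gcongr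
      _ = 1 / 8 := by field_simp; norm_num

end
end

section
/- Lower bound for approximation of antiderivatives by logarithmic-derivative families (first order): fix l = m + α with m ≥ 1 integer and 0 < α ≤ 1. Let ψ(x,ζ) be defined on [0,1] × ℂ^N, of class C¹ in x, such that ψ and ∂ψ/∂x are continuous in x, entire in ζ, and satisfy the exponential growth bound sup_x |·| ≤ A·e^{uN^v}·e^{bN^t‖ζ‖₁^d} with A,u,v,b,t,d ∈ [1,∞); assume |1/ψ(0,ζ)| ≤ C₀ e^{α₀ N^{β₀}} for all ζ with |ζ_j| ≤ B₁ N^{r₁}. Let b_N > 0 be such that b_N and 1/b_N are bounded polynomially in N. Then there exists a constant C̃ > 0 (depending only on l and the growth constants) and a function h ∈ Λ_l([0,1]) ∩ C^m([0,1]) vanishing identically on [0,1/20], such that for all ζ ∈ ℝ^N with |ζ_j| ≤ B₁ N^{r₁} for every j = 1,…,N: sup_{x ∈ [0,1]} | ∫₀^x h(t) dt − (1/b_N)·( (∂ψ/∂x)/ψ )(x,ζ) | ≥ C̃ / ( N^{l+1} (ln N)^{l+1} ). -/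
open Set

noncomputable section

/-- The interval `I = [0,1]`. -/
def I01 : Set ℝ := Icc 0 1

/-- The one-dimensional Hölder class `Λ_l([0,1])`, `l = m + α`, `0 < α ≤ 1`. -/
def HolderClass1 (m : ℕ) (α : ℝ) (f : ℝ → ℝ) : Prop :=
  ContDiffOn ℝ m f I01 ∧
  (∀ j ≤ m, ∀ x ∈ I01, |iteratedDerivWithin j f I01 x| ≤ 1) ∧
  ∀ x ∈ I01, ∀ y ∈ I01,
    |iteratedDerivWithin m f I01 x - iteratedDerivWithin m f I01 y| ≤ |x - y| ^ α

/-- families `g ζ z`, entire in `z`, whose Taylor coefficients are polynomials in `ζ`. -/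
def PT {N : ℕ} (g : (Fin N → ℝ) → ℂ → ℂ) : Prop :=
  (∀ ζ, Differentiable ℂ (g ζ)) ∧
  ∀ k : ℕ, ∃ P : MvPolynomial (Fin N) ℂ, P.totalDegree ≤ k ∧
    ∀ ζ : Fin N → ℝ, iteratedDeriv k (g ζ) 0 = MvPolynomial.eval (fun j => (ζ j : ℂ)) P

lemma PT.mul {N : ℕ} {f g : (Fin N → ℝ) → ℂ → ℂ} (hf : PT f) (hg : PT g) :
    PT (fun ζ z => f ζ z * g ζ z) := by
  refine ⟨fun ζ => (hf.1 ζ).mul (hg.1 ζ), fun k => ?_⟩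
  choose P hP1 hP2 using hf.2
  choose Q hQ1 hQ2 using hg.2
  refine ⟨∑ i ∈ Finset.range (k + 1), MvPolynomial.C ((k.choose i : ℕ) : ℂ) * P i * Q (k - i), ?_, ?_⟩
  · apply MvPolynomial.totalDegree_finsetSum_le
    intro i hi
    have hi' : i ≤ k := by simpa [Nat.lt_succ_iff] using hi
    refine (MvPolynomial.totalDegree_mul _ _).trans ?_
    have h1 := MvPolynomial.totalDegree_mul (MvPolynomial.C ((k.choose i : ℕ) : ℂ)) (P i)
    rw [MvPolynomial.totalDegree_C] at h1
    have := hP1 i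
    have := hQ1 (k - i)
    omega
  · intro ζ
    rw [iteratedDeriv_fun_mul ((hf.1 ζ).contDiff.contDiffAt) ((hg.1 ζ).contDiff.contDiffAt)]
    simp [hP2, hQ2]

lemma PT.const {N : ℕ} (c : ℂ) : PT (fun (_ : Fin N → ℝ) _ => c) := by
  refine ⟨fun ζ => differentiable_const c, fun k => ?_⟩
  refine ⟨MvPolynomial.C (if k = 0 then c else 0), by simp, fun ζ => ?_⟩
  simp [iteratedDeriv_const]

lemma PT.add {N : ℕ} {f g : (Fin N → ℝ) → ℂ → ℂ} (hf : PT f) (hg : PT g) :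
    PT (fun ζ z => f ζ z + g ζ z) := by
  refine ⟨fun ζ => (hf.1 ζ).add (hg.1 ζ), fun k => ?_⟩
  obtain ⟨P, hP1, hP2⟩ := hf.2 k
  obtain ⟨Q, hQ1, hQ2⟩ := hg.2 k
  refine ⟨P + Q, (MvPolynomial.totalDegree_add _ _).trans (max_le hP1 hQ1), fun ζ => ?_⟩
  rw [iteratedDeriv_fun_add ((hf.1 ζ).contDiff.contDiffAt) ((hg.1 ζ).contDiff.contDiffAt)]
  simp [hP2, hQ2]

lemma PT.prod {N : ℕ} {ι : Type*} (s : Finset ι) {f : ι → (Fin N → ℝ) → ℂ → ℂ}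
    (hf : ∀ i, PT (f i)) : PT (fun ζ z => ∏ i ∈ s, f i ζ z) := by
  classical
  induction s using Finset.induction_on with
  | empty => simpa using PT.const 1
  | insert a s ha ih =>
    simp only [Finset.prod_insert ha]
    exact (hf a).mul ih

lemma iteratedDeriv_conj_conj' (k : ℕ) (f : ℂ → ℂ) :
    iteratedDeriv k (⇑(starRingEnd ℂ) ∘ f ∘ ⇑(starRingEnd ℂ)) =
      ⇑(starRingEnd ℂ) ∘ iteratedDeriv k f ∘ ⇑(starRingEnd ℂ) := by
  induction k with
  | zero => simp
  | succ n ih => rw [iteratedDeriv_succ, ih, deriv_conj_conj, iteratedDeriv_succ]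

lemma PT.conj {N : ℕ} {f : (Fin N → ℝ) → ℂ → ℂ} (hf : PT f) :
    PT (fun ζ z => (starRingEnd ℂ) (f ζ ((starRingEnd ℂ) z))) := by
  refine ⟨fun ζ z => ?_, fun k => ?_⟩
  · have := ((hf.1 ζ) ((starRingEnd ℂ) z)).conj_conj
    simpa [Function.comp_def] using this
  · obtain ⟨P, hP1, hP2⟩ := hf.2 k
    refine ⟨MvPolynomial.map (starRingEnd ℂ) P, ?_, fun ζ => ?_⟩
    · refine le_trans ?_ hP1
      apply Finset.sup_mono
      exact MvPolynomial.support_map_subset _ _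
    · have := congrFun (iteratedDeriv_conj_conj' k (f ζ)) 0
      simp only [Function.comp_def, map_zero] at this
      rw [this, hP2, MvPolynomial.eval_map, MvPolynomial.eval, MvPolynomial.coe_eval₂Hom, MvPolynomial.hom_eval₂]
      simp

lemma PT.of_analytic {N : ℕ} {f : (Fin N → ℂ) → ℂ} (hf : AnalyticOnNhd ℂ f univ) :
    PT (fun (ζ : Fin N → ℝ) z => f (z • (fun j => (ζ j : ℂ)))) := by
  have hc : ContDiff ℂ ⊤ f := by
    rw [← contDiffOn_univ]; exact hf.contDiffOn uniqueDiffOn_univ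
  refine ⟨fun ζ => ?_, fun k => ?_⟩
  · exact (hc.differentiable (by simp)).comp (differentiable_id.smul_const _)
  · refine ⟨∑ r : Fin k → Fin N,
      MvPolynomial.C (iteratedFDeriv ℂ k f 0 (fun i => Pi.single (r i) 1)) *
        ∏ i, MvPolynomial.X (r i), ?_, fun ζ => ?_⟩
    · apply MvPolynomial.totalDegree_finsetSum_le
      intro r _
      refine (MvPolynomial.totalDegree_mul _ _).trans ?_
      rw [MvPolynomial.totalDegree_C, zero_add]
      refine (MvPolynomial.totalDegree_finsetProd _ _).trans ?_
      simp
    · set L : ℂ →L[ℂ] (Fin N → ℂ) :=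
        ContinuousLinearMap.toSpanSingleton ℂ (fun j => (ζ j : ℂ)) with hL
      have h1 : (fun z : ℂ => f (z • (fun j => (ζ j : ℂ)))) = f ∘ L := by
        ext z; simp [hL, ContinuousLinearMap.toSpanSingleton_apply]
      change iteratedDeriv k (fun z : ℂ => f (z • (fun j => (ζ j : ℂ)))) 0 = _
      rw [h1, iteratedDeriv_eq_iteratedFDeriv,
        L.iteratedFDeriv_comp_right hc 0 (i := k) (by simp)]
      have h2 : L 1 = ∑ j, (ζ j : ℂ) • (Pi.single j 1 : Fin N → ℂ) := by
        ext j
        simp [hL, ContinuousLinearMap.toSpanSingleton_apply, Finset.sum_apply, Pi.single_apply]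
      simp only [ContinuousMultilinearMap.compContinuousLinearMap_apply, h2, map_zero]
      have h3 := (iteratedFDeriv ℂ k f 0).toMultilinearMap.map_sum
        (fun (_ : Fin k) (j : Fin N) => (ζ j : ℂ) • (Pi.single j 1 : Fin N → ℂ))
      simp only [ContinuousMultilinearMap.coe_coe] at h3
      rw [h3, map_sum]
      refine Finset.sum_congr rfl fun r _ => ?_
      have h4 := (iteratedFDeriv ℂ k f 0).toMultilinearMap.map_smul_univ
        (fun i => (ζ (r i) : ℂ)) (fun i => (Pi.single (r i) 1 : Fin N → ℂ))
      simp only [ContinuousMultilinearMap.coe_coe] at h4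
      rw [h4]
      simp [mul_comm]

/-- Truncation. -/
lemma PT.trunc {N : ℕ} {g : (Fin N → ℝ) → ℂ → ℂ} (hg : PT g) (D : ℕ) :
    ∃ P : MvPolynomial (Fin N) ℂ, P.totalDegree ≤ D ∧
    ∀ ζ : Fin N → ℝ, ∀ B : ℝ, (∀ z : ℂ, ‖z‖ ≤ 2 → ‖g ζ z‖ ≤ B) →
      ‖MvPolynomial.eval (fun j => (ζ j : ℂ)) P - g ζ 1‖ ≤ B * (1 / 2) ^ D := by
  choose P hP1 hP2 using hg.2
  refine ⟨∑ k ∈ Finset.range (D + 1), MvPolynomial.C ((k.factorial : ℂ)⁻¹) * P k, ?_, ?_⟩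
  · apply MvPolynomial.totalDegree_finsetSum_le
    intro i hi
    have hi' : i ≤ D := by simpa [Nat.lt_succ_iff] using hi
    refine (MvPolynomial.totalDegree_mul _ _).trans ?_
    rw [MvPolynomial.totalDegree_C, zero_add]
    exact (hP1 i).trans hi'
  · intro ζ B hB
    have hs := Complex.hasSum_taylorSeries_of_entire (hg.1 ζ) 0 1
    simp only [sub_zero, one_pow, smul_eq_mul, one_mul] at hs
    have hb : ∀ n, ‖((n.factorial : ℂ))⁻¹ * iteratedDeriv n (g ζ) 0‖ ≤ B * (1 / 2) ^ n := by
      intro n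
      have := Complex.norm_iteratedDeriv_le_of_forall_mem_sphere_norm_le (c := 0) (R := 2) (C := B)
        (f := g ζ) n (by norm_num) (hg.1 ζ).diffContOnCl
        (fun z hz => hB z (by simpa using (mem_sphere_zero_iff_norm.1 hz).le))
      rw [norm_mul, norm_inv, Complex.norm_natCast]
      have hp : (0 : ℝ) < n.factorial := by exact_mod_cast n.factorial_pos
      rw [inv_mul_le_iff₀ hp]
      refine this.trans (le_of_eq ?_)
      rw [div_pow, one_pow]; ring
    have e1 : MvPolynomial.eval (fun j => (ζ j : ℂ))
        (∑ k ∈ Finset.range (D + 1), MvPolynomial.C ((k.factorial : ℂ)⁻¹) * P k) =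
        ∑ k ∈ Finset.range (D + 1), (k.factorial : ℂ)⁻¹ * iteratedDeriv k (g ζ) 0 := by
      simp [hP2]
    rw [e1, norm_sub_rev, ← hs.tsum_eq, ← hs.summable.sum_add_tsum_nat_add (D + 1), add_sub_cancel_left]
    have hgeo : HasSum (fun i : ℕ => B * (1 / 2 : ℝ) ^ (i + (D + 1))) (B * (1 / 2) ^ D) := by
      have := hasSum_geometric_two.mul_left (B * (1 / 2) ^ (D + 1))
      have e2 : (fun i : ℕ => B * (1 / 2 : ℝ) ^ (i + (D + 1))) =
          fun i : ℕ => B * (1 / 2 : ℝ) ^ (D + 1) * (1 / 2) ^ i := by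
        funext i; rw [pow_add]; ring
      have e3 : B * (1 / 2 : ℝ) ^ D = B * (1 / 2) ^ (D + 1) * 2 := by rw [pow_succ]; ring
      rw [e2, e3]; exact this
    exact tsum_of_norm_bounded hgeo (fun i => hb _)

/-- sign of a boolean -/
def sgb (b : Bool) : ℝ := if b then 1 else -1

/-- characters -/
def chr {M : ℕ} (τ σ : Fin M → Bool) : ℝ := ∏ i, (if τ i then sgb (σ i) else 1)

lemma chr_orth {M : ℕ} (τ τ' : Fin M → Bool) :
    ∑ σ : Fin M → Bool, chr τ σ * chr τ' σ = if τ = τ' then (2 : ℝ) ^ M else 0 := by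
  have h := Finset.prod_univ_sum (fun _ : Fin M => (Finset.univ : Finset Bool))
    (fun i b => (if τ i then sgb b else 1) * (if τ' i then sgb b else 1))
  rw [Fintype.piFinset_univ] at h
  simp only [chr, ← Finset.prod_mul_distrib]
  rw [← h]
  split_ifs with hτ
  · subst hτ
    have : ∀ i : Fin M, ∑ b : Bool, ((if τ i then sgb b else 1) * (if τ i then sgb b else 1)) = (2 : ℝ) := by
      intro i
      cases τ i <;> simp [sgb] <;> norm_num
    rw [Finset.prod_congr rfl (fun i _ => this i)]; simp
  · obtain ⟨i, hi⟩ := Function.ne_iff.1 hτ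
    apply Finset.prod_eq_zero (Finset.mem_univ i)
    revert hi
    cases τ i <;> cases τ' i <;> simp [sgb]

lemma rank_bound {M : ℕ} {ι : Type*} [Fintype ι]
    (mono : ι → EuclideanSpace ℂ (Fin M → Bool))
    (p : (Fin M → Bool) → EuclideanSpace ℂ (Fin M → Bool))
    (hp : ∀ τ, p τ ∈ Submodule.span ℂ (range mono)) (q P : ℝ) (hq : 0 ≤ q)
    (h1 : ∀ τ σ, ‖p τ σ‖ ≤ P) (h2 : ∀ τ σ, q ≤ ((p τ σ) * (chr τ σ : ℂ)).re) :
    q ^ 2 * 2 ^ M ≤ P ^ 2 * Fintype.card ι := by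
  classical
  set V := Submodule.span ℂ (range mono) with hV
  set n : ℝ := 2 ^ M with hn
  have hn0 : 0 < n := by positivity
  have hcard : (Fintype.card (Fin M → Bool) : ℝ) = n := by simp [hn]
  let X : (Fin M → Bool) → EuclideanSpace ℂ (Fin M → Bool) :=
    fun τ => WithLp.toLp 2 (fun σ => ((chr τ σ : ℝ) : ℂ))
  let c : ℂ := ((Real.sqrt n)⁻¹ : ℝ)
  have hXX : ∀ τ τ', inner ℂ (X τ) (X τ') = if τ = τ' then (n : ℂ) else 0 := by
    intro τ τ'
    have := chr_orth τ τ'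
    rw [PiLp.inner_apply]
    simp only [X, RCLike.inner_apply, Complex.conj_ofReal]
    have h' : ((∑ σ : Fin M → Bool, chr τ σ * chr τ' σ : ℝ) : ℂ) = if τ = τ' then (n : ℂ) else 0 := by
      rw [this]; split_ifs <;> simp [hn]
    rw [← h']; push_cast
    exact Finset.sum_congr rfl fun _ _ => mul_comm _ _
  have hon : Orthonormal ℂ (fun τ => c • X τ) := by
    rw [orthonormal_iff_ite]
    intro τ τ'
    rw [inner_smul_left, inner_smul_right, hXX]
    split_ifs
    · simp only [c, Complex.conj_ofReal]
      rw [← Complex.ofReal_mul, ← Complex.ofReal_mul]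
      have : (Real.sqrt n)⁻¹ * ((Real.sqrt n)⁻¹ * n) = 1 := by
        have h := Real.mul_self_sqrt hn0.le
        have h0 : Real.sqrt n ≠ 0 := (Real.sqrt_pos.2 hn0).ne'
        field_simp
        nlinarith
      rw [this]; simp
    · simp
  have hbes : ∀ v : EuclideanSpace ℂ (Fin M → Bool), ∑ τ, ‖inner ℂ (X τ) v‖ ^ 2 ≤ n * ‖v‖ ^ 2 := by
    intro v
    have := hon.sum_inner_products_le v (s := Finset.univ)
    have e : ∀ τ, ‖inner ℂ (c • X τ) v‖ ^ 2 = n⁻¹ * ‖inner ℂ (X τ) v‖ ^ 2 := by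
      intro τ
      rw [inner_smul_left, norm_mul, mul_pow]
      congr 1
      simp only [c, Complex.conj_ofReal, Complex.norm_real, Real.norm_eq_abs, sq_abs, inv_pow, Real.sq_sqrt hn0.le]
    simp only [e, ← Finset.mul_sum] at this
    rwa [inv_mul_le_iff₀ hn0] at this
  let bs := stdOrthonormalBasis ℂ V
  have hpn : ∀ τ, ‖p τ‖ ^ 2 ≤ n * P ^ 2 := by
    intro τ
    rw [EuclideanSpace.norm_sq_eq]
    refine (Finset.sum_le_sum (fun σ _ => pow_le_pow_left₀ (norm_nonneg _) (h1 τ σ) 2)).trans ?_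
    rw [Finset.sum_const, nsmul_eq_mul, Finset.card_univ, hcard]
  have hin : ∀ τ, q * n ≤ ‖inner ℂ (X τ) (p τ)‖ := by
    intro τ
    refine le_trans ?_ (Complex.re_le_norm _)
    rw [PiLp.inner_apply]
    simp only [X, RCLike.inner_apply, Complex.conj_ofReal, Complex.re_sum]
    refine le_trans ?_ (Finset.sum_le_sum (fun σ _ => h2 τ σ))
    rw [Finset.sum_const, nsmul_eq_mul, Finset.card_univ, hcard, mul_comm]
  have hkey : ∀ τ, (q * n) ^ 2 ≤ (n * P ^ 2) * ∑ k, ‖inner ℂ (X τ) (bs k : EuclideanSpace ℂ (Fin M → Bool))‖ ^ 2 := by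
    intro τ
    let pv : V := ⟨p τ, hp τ⟩
    have hexp : p τ = ∑ k, (inner ℂ (bs k) pv) • (bs k : EuclideanSpace ℂ (Fin M → Bool)) := by
      have := congrArg (Subtype.val) (bs.sum_repr' pv)
      simpa [pv] using this.symm
    have hnorm : ∑ k, ‖inner ℂ (bs k) pv‖ ^ 2 = ‖p τ‖ ^ 2 := by
      have := bs.sum_sq_norm_inner_right pv
      simpa [pv] using this
    have h3 : ‖inner ℂ (X τ) (p τ)‖ ≤ ∑ k, ‖inner ℂ (bs k) pv‖ * ‖inner ℂ (X τ) (bs k : EuclideanSpace ℂ (Fin M → Bool))‖ := by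
      conv_lhs => rw [hexp]
      rw [inner_sum]
      refine (norm_sum_le _ _).trans (le_of_eq ?_)
      refine Finset.sum_congr rfl fun k _ => ?_
      rw [inner_smul_right, norm_mul]
    calc (q * n) ^ 2 ≤ (∑ k, ‖inner ℂ (bs k) pv‖ * ‖inner ℂ (X τ) (bs k : EuclideanSpace ℂ (Fin M → Bool))‖) ^ 2 :=
          pow_le_pow_left₀ (by positivity) ((hin τ).trans h3) 2
      _ ≤ (∑ k, ‖inner ℂ (bs k) pv‖ ^ 2) * ∑ k, ‖inner ℂ (X τ) (bs k : EuclideanSpace ℂ (Fin M → Bool))‖ ^ 2 :=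
          Finset.sum_mul_sq_le_sq_mul_sq _ _ _
      _ ≤ _ := by
          rw [hnorm]
          exact mul_le_mul_of_nonneg_right (hpn τ) (Finset.sum_nonneg fun _ _ => by positivity)
  have hsum := Finset.sum_le_sum (fun τ (_ : τ ∈ (Finset.univ : Finset (Fin M → Bool))) => hkey τ)
  rw [Finset.sum_const, nsmul_eq_mul, Finset.card_univ, hcard, ← Finset.mul_sum, Finset.sum_comm] at hsum
  have hfr : (Module.finrank ℂ V : ℝ) ≤ Fintype.card ι := by
    exact_mod_cast finrank_range_le_card mono
  have hsum2 : ∑ k, ∑ τ, ‖inner ℂ (X τ) (bs k : EuclideanSpace ℂ (Fin M → Bool))‖ ^ 2 ≤ (Fintype.card ι : ℝ) * n := by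
    refine (Finset.sum_le_sum (fun k _ => hbes (bs k))).trans ?_
    have : ∀ k, ‖(bs k : EuclideanSpace ℂ (Fin M → Bool))‖ = 1 := by
      intro k
      exact bs.norm_eq_one k
    simp only [this, one_pow, mul_one, Finset.sum_const, nsmul_eq_mul, Finset.card_univ, Fintype.card_fin]
    exact mul_le_mul_of_nonneg_right hfr hn0.le
  have h5 : n * (q * n) ^ 2 ≤ n * P ^ 2 * ((Fintype.card ι : ℝ) * n) :=
    hsum.trans (mul_le_mul_of_nonneg_left hsum2 (by positivity))
  have h6 : (n * n) * (q ^ 2 * n) ≤ (n * n) * (P ^ 2 * Fintype.card ι) := by nlinarith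
  exact le_of_mul_le_mul_left h6 (by positivity)


lemma core {N M D : ℕ} (n d : Fin M → (Fin N → ℝ) → ℂ → ℂ) (hn : ∀ i, PT (n i))
    (hd : ∀ i, PT (d i)) (Z : (Fin M → Bool) → Fin N → ℝ) (B0 δ0 : ℝ) (hδ : 0 < δ0)
    (hnB : ∀ i σ z, ‖z‖ ≤ 2 → ‖n i (Z σ) z‖ ≤ B0)
    (hdB : ∀ i σ z, ‖z‖ ≤ 2 → ‖d i (Z σ) z‖ ≤ B0)
    (hdl : ∀ i σ, δ0 ≤ ‖d i (Z σ) 1‖) (y : Fin M → (Fin M → Bool) → ℝ)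
    (hy : ∀ i σ, n i (Z σ) 1 = (y i σ : ℂ) * d i (Z σ) 1)
    (hys : ∀ i σ, |y i σ - sgb (σ i)| ≤ 1 / 10)
    (hsmall : (B0 / δ0) ^ M * (1 / 2) ^ D ≤ 1 / 2 * (9 / 10) ^ M) :
    (2 : ℝ) ^ M ≤ 16 * (121 / 81) ^ M * ((D : ℝ) + 1) ^ N := by
  classical
  have hG : ∀ τ : Fin M → Bool, PT (fun ζ z => ∏ i, (if τ i then n i ζ z else d i ζ z)) := by
    intro τ
    refine PT.prod Finset.univ (f := fun i ζ z => if τ i then n i ζ z else d i ζ z) (fun i => ?_)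
    cases τ i <;> simp [hn, hd]
  choose P hP1 hP2 using fun τ => (hG τ).trunc D
  let W : (Fin M → Bool) → ℂ := fun σ => ∏ i, d i (Z σ) 1
  have hW : ∀ σ, δ0 ^ M ≤ ‖W σ‖ := by
    intro σ
    simp only [W, norm_prod]
    calc δ0 ^ M = ∏ i : Fin M, δ0 := by simp
      _ ≤ _ := Finset.prod_le_prod (fun _ _ => hδ.le) (fun i _ => hdl i σ)
  have hW0 : ∀ σ, 0 < ‖W σ‖ := fun σ => lt_of_lt_of_le (by positivity) (hW σ)
  have hW0' : ∀ σ, W σ ≠ 0 := fun σ => norm_pos_iff.1 (hW0 σ)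
  let p : (Fin M → Bool) → EuclideanSpace ℂ (Fin M → Bool) := fun τ =>
    WithLp.toLp 2 (fun σ => MvPolynomial.eval (fun j => (Z σ j : ℂ)) (P τ) / W σ)
  let mono : (Fin N → Fin (D + 1)) → EuclideanSpace ℂ (Fin M → Bool) := fun e =>
    WithLp.toLp 2 (fun σ => (∏ j, (Z σ j : ℂ) ^ (e j : ℕ)) / W σ)
  let f : (Fin M → Bool) → (Fin M → Bool) → ℝ := fun τ σ => ∏ i, (if τ i then y i σ else 1)
  have hfG : ∀ τ σ, (∏ i, (if τ i then n i (Z σ) 1 else d i (Z σ) 1)) = (f τ σ : ℂ) * W σ := by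
    intro τ σ
    simp only [f, W]
    rw [Complex.ofReal_prod, ← Finset.prod_mul_distrib]
    refine Finset.prod_congr rfl fun i _ => ?_
    split_ifs
    · exact hy i σ
    · simp
  have hsg : ∀ b, sgb b * sgb b = 1 := by intro b; cases b <;> simp [sgb]
  have hfc : ∀ τ σ, f τ σ * chr τ σ = ∏ i, (if τ i then y i σ * sgb (σ i) else 1) := by
    intro τ σ
    simp only [f, chr, ← Finset.prod_mul_distrib]
    refine Finset.prod_congr rfl fun i _ => ?_
    split_ifs <;> simp
  have hys' : ∀ i σ, 9 / 10 ≤ y i σ * sgb (σ i) ∧ y i σ * sgb (σ i) ≤ 11 / 10 := by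
    intro i σ
    have := abs_le.1 (hys i σ)
    cases h : σ i <;> simp only [h, sgb] at this ⊢ <;> norm_num at this ⊢ <;> constructor <;> linarith [this.1, this.2]
  have hlow : ∀ τ σ, (9 / 10 : ℝ) ^ M ≤ f τ σ * chr τ σ := by
    intro τ σ
    rw [hfc]
    calc (9 / 10 : ℝ) ^ M = ∏ i : Fin M, (9 / 10 : ℝ) := by
          rw [Finset.prod_const, Finset.card_univ, Fintype.card_fin]
      _ ≤ _ := Finset.prod_le_prod (fun _ _ => by norm_num) (fun i _ => by
        split_ifs
        · exact (hys' i σ).1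
        · norm_num)
  have hup : ∀ τ σ, f τ σ * chr τ σ ≤ (11 / 10 : ℝ) ^ M := by
    intro τ σ
    rw [hfc]
    calc _ ≤ ∏ i : Fin M, (11 / 10 : ℝ) := Finset.prod_le_prod (fun i _ => by
            split_ifs
            · linarith [(hys' i σ).1]
            · norm_num) (fun i _ => by
        split_ifs
        · exact (hys' i σ).2
        · norm_num)
      _ = _ := by rw [Finset.prod_const, Finset.card_univ, Fintype.card_fin]
  have hchr : ∀ τ σ : Fin M → Bool, |chr τ σ| = 1 := by
    intro τ σ
    simp only [chr, Finset.abs_prod]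
    apply Finset.prod_eq_one
    intro i _
    cases τ i <;> cases σ i <;> simp [sgb]
  have herr : ∀ τ σ, ‖p τ σ - (f τ σ : ℂ)‖ ≤ 1 / 2 * (9 / 10) ^ M := by
    intro τ σ
    have h1 := hP2 τ (Z σ) (B0 ^ M) (fun z hz => by
      rw [norm_prod]
      calc _ ≤ ∏ i : Fin M, B0 := Finset.prod_le_prod (fun _ _ => norm_nonneg _) (fun i _ => by
            split_ifs
            · exact hnB i σ z hz
            · exact hdB i σ z hz)
        _ = _ := by simp)
    rw [hfG] at h1
    have h2 : p τ σ - (f τ σ : ℂ) =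
        (MvPolynomial.eval (fun j => (Z σ j : ℂ)) (P τ) - (f τ σ : ℂ) * W σ) / W σ := by
      simp only [p]
      have := hW0' σ
      field_simp
    rw [h2, norm_div]
    have hB0' : 0 ≤ B0 ^ M * (1 / 2) ^ D := (norm_nonneg _).trans h1
    calc _ ≤ B0 ^ M * (1 / 2) ^ D / δ0 ^ M := by
          apply div_le_div₀ hB0' h1 (by positivity) (hW σ)
      _ = (B0 / δ0) ^ M * (1 / 2) ^ D := by rw [div_pow]; ring
      _ ≤ _ := hsmall
  have h910 : (9 / 10 : ℝ) ^ M ≤ 1 := pow_le_one₀ (by norm_num) (by norm_num)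
  have h1110 : (1 : ℝ) ≤ (11 / 10) ^ M := one_le_pow₀ (by norm_num)
  have hres := rank_bound mono p (fun τ => ?_) (1 / 2 * (9 / 10) ^ M) (2 * (11 / 10) ^ M)
    (by positivity) (fun τ σ => ?_) (fun τ σ => ?_)
  · have e : ((Fintype.card (Fin N → Fin (D + 1)) : ℕ) : ℝ) = ((D : ℝ) + 1) ^ N := by
      simp
    rw [e] at hres
    have e1 : ((1 / 2 * (9 / 10) ^ M) ^ 2 : ℝ) = 1 / 4 * (81 / 100) ^ M := by
      rw [mul_pow, ← pow_mul, mul_comm M 2, pow_mul]; norm_num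
    have e2 : ((2 * (11 / 10) ^ M) ^ 2 : ℝ) = 4 * (121 / 100) ^ M := by
      rw [mul_pow, ← pow_mul, mul_comm M 2, pow_mul]; norm_num
    have e3 : (121 / 100 : ℝ) ^ M = (121 / 81) ^ M * (81 / 100) ^ M := by
      rw [← mul_pow]; norm_num
    rw [e1, e2, e3] at hres
    have hpos : (0 : ℝ) < (81 / 100) ^ M := by positivity
    have : (81 / 100 : ℝ) ^ M * (2 : ℝ) ^ M ≤ (81 / 100) ^ M * (16 * (121 / 81) ^ M * ((D : ℝ) + 1) ^ N) := by
      nlinarith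
    exact le_of_mul_le_mul_left this hpos
  · have hmem : p τ = ∑ s ∈ (P τ).support, (P τ).coeff s •
        mono (fun j => Fin.ofNat (D + 1) (s j)) := by
      ext σ
      simp only [p, mono, MvPolynomial.eval_eq', Finset.sum_div]
      simp only [WithLp.ofLp_sum, WithLp.ofLp_smul, Finset.sum_apply, Pi.smul_apply, smul_eq_mul]
      refine Finset.sum_congr rfl fun s hs => ?_
      rw [mul_div_assoc]
      congr 2
      refine Finset.prod_congr rfl fun j _ => ?_
      have : s j ≤ D := (MvPolynomial.monomial_le_degreeOf j hs).trans
        ((MvPolynomial.degreeOf_le_totalDegree _ _).trans (hP1 τ))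
      rw [Fin.val_ofNat, Nat.mod_eq_of_lt (by omega)]
    rw [hmem]
    exact Submodule.sum_mem _ fun s _ => Submodule.smul_mem _ _ (Submodule.subset_span ⟨_, rfl⟩)
  · have h3 : ‖(f τ σ : ℂ)‖ ≤ (11 / 10) ^ M := by
      rw [Complex.norm_real, Real.norm_eq_abs]
      have : |f τ σ| = |f τ σ * chr τ σ| := by rw [abs_mul, hchr, mul_one]
      rw [this, abs_of_nonneg (le_trans (by positivity) (hlow τ σ))]
      exact hup τ σ
    have := norm_le_norm_add_norm_sub' (p τ σ) (f τ σ : ℂ)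
    linarith [herr τ σ]
  · have h4 : p τ σ * (chr τ σ : ℂ) = ((f τ σ * chr τ σ : ℝ) : ℂ) + (p τ σ - f τ σ) * (chr τ σ : ℂ) := by
      push_cast; ring
    rw [h4, Complex.add_re, Complex.ofReal_re]
    have h5 : ‖(p τ σ - f τ σ) * (chr τ σ : ℂ)‖ ≤ 1 / 2 * (9 / 10) ^ M := by
      rw [norm_mul, Complex.norm_real, Real.norm_eq_abs, hchr, mul_one]; exact herr τ σ
    have h6 := (abs_le.1 (Complex.abs_re_le_norm ((p τ σ - f τ σ) * (chr τ σ : ℂ)))).1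
    linarith [hlow τ σ]

lemma gron (f f' : ℝ → ℂ) (K : ℝ) (hK : 0 ≤ K)
    (hder : ∀ x ∈ Icc (0:ℝ) 1, HasDerivWithinAt f (f' x) (Icc 0 1) x)
    (hc : ContinuousOn f' (Icc 0 1)) (hq : ∀ x ∈ Icc (0:ℝ) 1, ‖f' x / f x‖ ≤ K)
    (x0 : ℝ) (hx0 : x0 ∈ Icc (0:ℝ) 1) (hne : f x0 ≠ 0) :
    f 0 ≠ 0 ∧ ‖f 0‖ ≤ ‖f x0‖ * Real.exp K := by
  have hfc : ContinuousOn f (Icc 0 1) := fun x hx => (hder x hx).continuousWithinAt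
  have hbd : ∀ x ∈ Icc (0:ℝ) 1, f x ≠ 0 → ‖f' x‖ ≤ K * ‖f x‖ := by
    intro x hx h
    have := hq x hx
    rwa [norm_div, div_le_iff₀ (norm_pos_iff.2 h)] at this
  have hb : ∀ x ∈ Icc (0:ℝ) 1, ‖f' x‖ ≤ K * ‖f x‖ := by
    intro x hx
    by_cases h : f x = 0
    · by_contra hcon
      have hf' : f' x ≠ 0 := by
        rintro h0; apply hcon; simp [h, h0]
      have hev := (hder x hx).eventually_ne (c := 0) hf'
      have hev2 : ∀ᶠ z in nhdsWithin x (Icc (0:ℝ) 1 \ {x}), ‖f' z‖ ≤ K * ‖f z‖ := by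
        filter_upwards [hev, self_mem_nhdsWithin] with z hz hz2
        exact hbd z hz2.1 hz
      have hacc : (nhdsWithin x (Icc (0:ℝ) 1 \ {x})).NeBot :=
        accPt_principal_iff_nhdsWithin.1
          (uniqueDiffWithinAt_iff_accPt.1 (uniqueDiffOn_Icc_zero_one x hx))
      have t1 : Filter.Tendsto (fun z => ‖f' z‖) (nhdsWithin x (Icc (0:ℝ) 1 \ {x})) (nhds ‖f' x‖) :=
        ((hc x hx).mono sdiff_subset).norm
      have t2 : Filter.Tendsto (fun z => K * ‖f z‖) (nhdsWithin x (Icc (0:ℝ) 1 \ {x})) (nhds (K * ‖f x‖)) :=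
        (((hfc x hx).mono sdiff_subset).norm).const_mul K
      exact hcon (le_of_tendsto_of_tendsto t1 t2 hev2)
    · exact hbd x hx h
  constructor
  · intro h0
    have := norm_le_gronwallBound_of_norm_deriv_right_le (f := f) (f' := f') (δ := 0) (K := K) (ε := 0)
      (a := 0) (b := 1) hfc (fun x hx => (hder x (Ico_subset_Icc_self hx)).mono_of_mem_nhdsWithin
        (Icc_mem_nhdsGE_of_mem hx)) (by simp [h0]) (fun x hx => by
          simpa using hb x (Ico_subset_Icc_self hx)) x0 hx0
    rw [gronwallBound_ε0_δ0] at this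
    exact hne (norm_le_zero_iff.1 this)
  · have hmap : ∀ s ∈ Icc (0:ℝ) x0, x0 - s ∈ Icc (0:ℝ) 1 := fun s hs =>
      ⟨by linarith [hs.2], by linarith [hs.1, hx0.2]⟩
    have := norm_le_gronwallBound_of_norm_deriv_right_le (f := fun s => f (x0 - s))
      (f' := fun s => - f' (x0 - s)) (δ := ‖f x0‖) (K := K) (ε := 0)
      (a := 0) (b := x0) (hfc.comp (by fun_prop) hmap) (fun s hs => by
        have h1 : HasDerivWithinAt (fun s => x0 - s) (-1) (Icc 0 x0) s := by
          simpa using ((hasDerivAt_id s).const_sub x0).hasDerivWithinAt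
        have h2 := (hder (x0 - s) (hmap s (Ico_subset_Icc_self hs))).scomp s h1 hmap
        have h3 := h2.mono_of_mem_nhdsWithin (s := Ici s) (Icc_mem_nhdsGE_of_mem hs)
        simpa [Function.comp_def] using h3) (by simp) (fun s hs => by
          simpa using hb _ (hmap s (Ico_subset_Icc_self hs))) x0 ⟨hx0.1, le_rfl⟩
    rw [gronwallBound_ε0] at this
    simp only [sub_self, sub_zero] at this
    refine this.trans (mul_le_mul_of_nonneg_left (Real.exp_le_exp.2 ?_) (norm_nonneg _))
    nlinarith [hx0.2]

lemma sum_single_bound {M : ℕ} (g : ℝ → ℝ) (L : ℝ) (hL : 0 ≤ L)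
    (hs : ∀ x, g x ≠ 0 → |x - 1 / 2| ≤ 1 / 4) (hg : ∀ x, |g x| ≤ L) (σ : Fin M → Bool) (t : ℝ) :
    |∑ i : Fin M, sgb (σ i) * g (t - (i : ℕ))| ≤ L := by
  by_cases h : ∃ i : Fin M, g (t - (i : ℕ)) ≠ 0
  · obtain ⟨i, hi⟩ := h
    rw [Finset.sum_eq_single i]
    · rw [abs_mul]
      have : |sgb (σ i)| = 1 := by cases σ i <;> simp [sgb]
      rw [this, one_mul]; exact hg _
    · intro j _ hj
      by_contra hne
      have hj' := abs_le.1 (hs _ (right_ne_zero_of_mul hne))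
      have hi' := abs_le.1 (hs _ hi)
      apply hj
      apply Fin.ext
      have h1 : ((j : ℕ) : ℝ) < (i : ℕ) + 1 := by linarith [hj'.1, hi'.2, hi'.1, hj'.2]
      have h2 : ((i : ℕ) : ℝ) < (j : ℕ) + 1 := by linarith [hj'.1, hi'.2, hi'.1, hj'.2]
      have h3 : (j : ℕ) < (i : ℕ) + 1 := by exact_mod_cast h1
      have h4 : (i : ℕ) < (j : ℕ) + 1 := by exact_mod_cast h2
      omega
    · simp
  · push Not at h
    simp [h, hL]

/-- the basic smooth bump -/
def bmp : ContDiffBump (1 / 2 : ℝ) := ⟨1 / 8, 1 / 4, by norm_num, by norm_num⟩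

lemma bmp_tsupport (k : ℕ) : tsupport (iteratedDeriv k (bmp : ℝ → ℝ)) ⊆ Metric.closedBall (1 / 2) (1 / 4) := by
  induction k with
  | zero =>
    rw [iteratedDeriv_zero, bmp.tsupport_eq]; rfl
  | succ n ih =>
    rw [iteratedDeriv_succ]
    exact (closure_minimal support_deriv_subset (isClosed_tsupport _)).trans ih

lemma bmp_supp (k : ℕ) (x : ℝ) (h : iteratedDeriv k (bmp : ℝ → ℝ) x ≠ 0) : |x - 1 / 2| ≤ 1 / 4 := by
  have := bmp_tsupport k (subset_tsupport _ h)
  simpa [Real.dist_eq] using this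

lemma bmp_contDiff : ContDiff ℝ (⊤ : ℕ∞) (bmp : ℝ → ℝ) := bmp.contDiff

lemma bmp_iter_contDiff (k n : ℕ) : ContDiff ℝ n (iteratedDeriv k (bmp : ℝ → ℝ)) := by
  rw [iteratedDeriv_eq_iterate]
  exact (ContDiff.iterate_deriv' n k (bmp_contDiff.of_le (by exact_mod_cast le_top)))

lemma bmp_bound (n : ℕ) : ∃ L : ℝ, 1 ≤ L ∧ ∀ k ≤ n, ∀ x, |iteratedDeriv k (bmp : ℝ → ℝ) x| ≤ L := by
  have h : ∀ k, ∃ C : ℝ, ∀ x, |iteratedDeriv k (bmp : ℝ → ℝ) x| ≤ C := by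
    intro k
    have hcs : HasCompactSupport (iteratedDeriv k (bmp : ℝ → ℝ)) :=
      (isCompact_closedBall (1 / 2 : ℝ) (1 / 4)).of_isClosed_subset (isClosed_tsupport _) (bmp_tsupport k)
    exact hcs.exists_bound_of_continuous (bmp_iter_contDiff k 0).continuous
  choose C hC using h
  refine ⟨1 + ∑ k ∈ Finset.range (n + 1), |C k|, ?_, ?_⟩
  · have : 0 ≤ ∑ k ∈ Finset.range (n + 1), |C k| := Finset.sum_nonneg fun _ _ => abs_nonneg _
    linarith
  · intro k hk x
    have := Finset.single_le_sum (f := fun k => |C k|) (fun _ _ => abs_nonneg _)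
      (Finset.mem_range.2 (Nat.lt_succ_of_le hk))
    linarith [hC k x, le_abs_self (C k)]

/-- the combined bumps -/
def SB {M : ℕ} (σ : Fin M → Bool) (k : ℕ) (t : ℝ) : ℝ :=
  ∑ i : Fin M, sgb (σ i) * iteratedDeriv k (bmp : ℝ → ℝ) (t - (i : ℕ))

lemma SB_hasDerivAt {M : ℕ} (σ : Fin M → Bool) (k : ℕ) (t : ℝ) :
    HasDerivAt (SB σ k) (SB σ (k + 1) t) t := by
  unfold SB
  refine HasDerivAt.fun_sum fun i _ => HasDerivAt.const_mul _ ?_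
  have h : HasDerivAt (iteratedDeriv k (bmp : ℝ → ℝ))
      (iteratedDeriv (k + 1) (bmp : ℝ → ℝ) (t - (i : ℕ))) (t - (i : ℕ)) := by
    rw [iteratedDeriv_succ]
    exact ((bmp_iter_contDiff k 1).differentiable (by simp) _).hasDerivAt
  exact h.comp_sub_const t _

lemma SB_contDiff {M : ℕ} (σ : Fin M → Bool) (k n : ℕ) : ContDiff ℝ n (SB σ k) := by
  unfold SB
  refine ContDiff.sum fun i _ => contDiff_const.mul ?_
  exact (bmp_iter_contDiff k n).comp (contDiff_id.sub contDiff_const)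

lemma bump_family (m : ℕ) : ∃ L : ℝ, 1 ≤ L ∧ ∀ α : ℝ, 0 < α → α ≤ 1 → ∀ M : ℕ, 1 ≤ M →
    ∃ x : Fin M → ℝ, (∀ i, x i ∈ I01) ∧ ∀ σ : Fin M → Bool, ∀ a : ℝ, 0 < a →
      a * (2 * L * (2 * (M : ℝ)) ^ ((m : ℝ) + α + 1)) = 1 →
      ∃ h : ℝ → ℝ, HolderClass1 m α h ∧ (∀ x ∈ Icc (0:ℝ) (1/20), h x = 0) ∧
        (∀ y ∈ I01, |∫ s in (0:ℝ)..y, h s| ≤ a) ∧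
        ∀ i, ∫ s in (0:ℝ)..(x i), h s = a * sgb (σ i) := by
  obtain ⟨L, hL1, hL⟩ := bmp_bound (m + 2)
  refine ⟨L, hL1, fun α hα0 hα1 M hM => ?_⟩
  have hM' : (1 : ℝ) ≤ M := by exact_mod_cast hM
  refine ⟨fun i => 1 / 2 + ((i : ℕ) + 1 / 2) / (2 * M), fun i => ?_, fun σ a ha hae => ?_⟩
  · have hi : ((i : ℕ) : ℝ) + 1 ≤ M := by exact_mod_cast i.2
    have h0 : (0 : ℝ) ≤ (i : ℕ) := by positivity
    refine ⟨by positivity, ?_⟩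
    have : (((i : ℕ) : ℝ) + 1 / 2) / (2 * M) ≤ 1 / 2 := by
      rw [div_le_iff₀ (by positivity)]; linarith
    linarith
  set c : ℝ := 2 * M with hc
  have hc1 : 1 ≤ c := by linarith
  have hc0 : 0 < c := by linarith
  have hSB : ∀ k ≤ m + 2, ∀ t, |SB σ k t| ≤ L := fun k hk t =>
    sum_single_bound _ L (by linarith) (bmp_supp k) (hL k hk) σ t
  have hSB0 : ∀ t, |SB σ 0 t| ≤ 1 := fun t =>
    sum_single_bound _ 1 (by norm_num) (bmp_supp 0) (fun x => by
      rw [iteratedDeriv_zero, abs_of_nonneg bmp.nonneg]; exact bmp.le_one) σ t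
  have hSBz : ∀ k, ∀ t ≤ 0, SB σ k t = 0 := by
    intro k t ht
    unfold SB
    refine Finset.sum_eq_zero fun i _ => ?_
    by_contra hne
    have := abs_le.1 (bmp_supp k _ (right_ne_zero_of_mul hne))
    have h0 : (0 : ℝ) ≤ (i : ℕ) := by positivity
    linarith [this.1]
  have hder : ∀ k x, HasDerivAt (fun x => a * c ^ k * SB σ k (c * (x - 1 / 2)))
      (a * c ^ (k + 1) * SB σ (k + 1) (c * (x - 1 / 2))) x := by
    intro k x
    have h1 : HasDerivAt (fun x : ℝ => c * (x - 1 / 2)) c x := by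
      simpa using ((hasDerivAt_id x).sub_const (1 / 2 : ℝ)).const_mul c
    have h2 := ((SB_hasDerivAt σ k (c * (x - 1 / 2))).comp x h1).const_mul (a * c ^ k)
    have h3 : a * c ^ (k + 1) * SB σ (k + 1) (c * (x - 1 / 2)) =
        a * c ^ k * (SB σ (k + 1) (c * (x - 1 / 2)) * c) := by rw [pow_succ]; ring
    rw [h3]; exact h2
  set h : ℝ → ℝ := fun x => a * c ^ 1 * SB σ 1 (c * (x - 1 / 2)) with hh
  have hiter : ∀ j, iteratedDeriv j h = fun x => a * c ^ (j + 1) * SB σ (j + 1) (c * (x - 1 / 2)) := by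
    intro j
    induction j with
    | zero => simp [hh]
    | succ n ih =>
      rw [iteratedDeriv_succ, ih]
      funext x
      exact (hder (n + 1) x).deriv
  have hcd : ∀ n : ℕ, ContDiff ℝ n h := by
    intro n
    refine contDiff_const.mul ((SB_contDiff σ 1 n).comp ?_)
    exact contDiff_const.mul (contDiff_id.sub contDiff_const)
  have hw : ∀ j, ∀ x ∈ I01, iteratedDerivWithin j h I01 x =
      a * c ^ (j + 1) * SB σ (j + 1) (c * (x - 1 / 2)) := by
    intro j x hx
    have hu : UniqueDiffOn ℝ I01 := uniqueDiffOn_Icc_zero_one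
    rw [iteratedDerivWithin_eq_iteratedDeriv hu (hcd j).contDiffAt hx, hiter]
  have hcl : a * c ^ (m + 1) * (2 * L) * c ^ α = 1 := by
    rw [← hae]
    have : c ^ ((m : ℝ) + α + 1) = c ^ (m + 1) * c ^ α := by
      rw [← Real.rpow_natCast, ← Real.rpow_add hc0]
      congr 1; push_cast; ring
    rw [this]; ring
  have hcα : 1 ≤ c ^ α := Real.one_le_rpow hc1 hα0.le
  have hacm : a * c ^ (m + 1) * (2 * L) ≤ 1 := by
    have : 0 ≤ a * c ^ (m + 1) * (2 * L) := by positivity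
    nlinarith
  have hInteg : ∀ y, ∫ s in (0:ℝ)..y, h s = a * SB σ 0 (c * (y - 1 / 2)) := by
    intro y
    have := intervalIntegral.integral_eq_sub_of_hasDerivAt (a := 0) (b := y)
      (f := fun x => a * c ^ 0 * SB σ 0 (c * (x - 1 / 2))) (f' := h) (fun x _ => hder 0 x)
      ((hcd 0).continuous.intervalIntegrable _ _)
    rw [this, hSBz 0 (c * (0 - 1 / 2)) (by nlinarith)]
    simp
  refine ⟨h, ⟨(hcd m).contDiffOn, fun j hj x hx => ?_, fun x hx y hy => ?_⟩, fun x hx => ?_, fun y hy => ?_, fun i => ?_⟩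
  · rw [hw j x hx, abs_mul, abs_of_pos (by positivity)]
    have h1 : c ^ (j + 1) ≤ c ^ (m + 1) := pow_le_pow_right₀ hc1 (by omega)
    calc a * c ^ (j + 1) * |SB σ (j + 1) (c * (x - 1 / 2))| ≤ a * c ^ (m + 1) * (2 * L) := by
          apply mul_le_mul _ _ (abs_nonneg _) (by positivity)
          · exact mul_le_mul_of_nonneg_left h1 ha.le
          · linarith [hSB (j + 1) (by omega) (c * (x - 1 / 2))]
      _ ≤ 1 := hacm
  · rw [hw m x hx, hw m y hy, ← mul_sub, abs_mul, abs_of_pos (by positivity)]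
    set s := c * (x - 1 / 2) with hs
    set t := c * (y - 1 / 2) with ht
    have hst : |s - t| = c * |x - y| := by
      rw [hs, ht, ← mul_sub, abs_mul, abs_of_pos hc0]; congr 2; ring
    have hl : |SB σ (m + 1) s - SB σ (m + 1) t| ≤ L * |s - t| := by
      have := Convex.norm_image_sub_le_of_norm_hasDerivWithin_le (f := SB σ (m + 1))
        (f' := SB σ (m + 2)) (s := univ) (C := L) (x := t) (y := s)
        (fun z _ => (SB_hasDerivAt σ (m + 1) z).hasDerivWithinAt)
        (fun z _ => hSB (m + 2) le_rfl z) convex_univ (mem_univ _) (mem_univ _)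
      simpa [Real.norm_eq_abs] using this
    have hb2 : |SB σ (m + 1) s - SB σ (m + 1) t| ≤ 2 * L := by
      have h1 := hSB (m + 1) (by omega) s
      have h2 := hSB (m + 1) (by omega) t
      have := abs_sub (SB σ (m + 1) s) (SB σ (m + 1) t)
      linarith
    have hmin : |SB σ (m + 1) s - SB σ (m + 1) t| ≤ 2 * L * |s - t| ^ α := by
      rcases le_total 1 |s - t| with h1 | h1
      · have := Real.one_le_rpow h1 hα0.le
        nlinarith
      · have : |s - t| ≤ |s - t| ^ α := by
          rcases eq_or_lt_of_le (abs_nonneg (s - t)) with h0 | h0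
          · rw [← h0, Real.zero_rpow hα0.ne']
          · simpa using Real.rpow_le_rpow_of_exponent_ge h0 h1 hα1
        have h2 : 0 ≤ |s - t| := abs_nonneg _
        nlinarith
    calc a * c ^ (m + 1) * |SB σ (m + 1) s - SB σ (m + 1) t|
        ≤ a * c ^ (m + 1) * (2 * L * |s - t| ^ α) := mul_le_mul_of_nonneg_left hmin (by positivity)
      _ = (a * c ^ (m + 1) * (2 * L) * c ^ α) * |x - y| ^ α := by
          rw [hst, Real.mul_rpow hc0.le (abs_nonneg _)]; ring
      _ = |x - y| ^ α := by rw [hcl, one_mul]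
  · simp only [hh]
    rw [hSBz 1 _ (by nlinarith [hx.2]), mul_zero]
  · rw [hInteg, abs_mul, abs_of_pos ha]
    nlinarith [hSB0 (c * (y - 1 / 2))]
  · rw [hInteg]
    congr 1
    have : c * (1 / 2 + (((i : ℕ) : ℝ) + 1 / 2) / c - 1 / 2) = (i : ℕ) + 1 / 2 := by
      field_simp; ring
    rw [this]
    unfold SB
    rw [Finset.sum_eq_single i]
    · rw [add_sub_cancel_left, iteratedDeriv_zero, bmp.one_of_mem_closedBall, mul_one]
      exact Metric.mem_closedBall_self bmp.rIn_pos.le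
    · intro j _ hj
      by_contra hne
      have h1 := abs_le.1 (bmp_supp 0 _ (right_ne_zero_of_mul hne))
      apply hj
      apply Fin.ext
      have h1' : ((j : ℕ) : ℝ) < (i : ℕ) + 1 := by linarith [h1.1, h1.2]
      have h2' : ((i : ℕ) : ℝ) < (j : ℕ) + 1 := by linarith [h1.1, h1.2]
      have h3 : (j : ℕ) < (i : ℕ) + 1 := by exact_mod_cast h1'
      have h4 : (i : ℕ) < (j : ℕ) + 1 := by exact_mod_cast h2'
      omega
    · simp

/-- polynomially bounded functions on `[1,∞)` -/
def PB (f : ℝ → ℝ) : Prop :=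
  ∃ c : ℝ, 0 ≤ c ∧ ∃ κ : ℕ, ∀ Y : ℝ, 1 ≤ Y → 0 ≤ f Y ∧ f Y ≤ c * Y ^ κ

lemma PB.const {c : ℝ} (hc : 0 ≤ c) : PB (fun _ => c) :=
  ⟨c, hc, 0, fun Y _ => ⟨hc, by simp⟩⟩

lemma PB.id : PB (fun Y => Y) :=
  ⟨1, by norm_num, 1, fun Y hY => ⟨by linarith, by simp⟩⟩

lemma PB.add {f g : ℝ → ℝ} (hf : PB f) (hg : PB g) : PB (fun Y => f Y + g Y) := by
  obtain ⟨c, hc, k, h⟩ := hf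
  obtain ⟨c', hc', k', h'⟩ := hg
  refine ⟨c + c', by positivity, k + k', fun Y hY => ⟨add_nonneg (h Y hY).1 (h' Y hY).1, ?_⟩⟩
  have h1 : Y ^ k ≤ Y ^ (k + k') := pow_le_pow_right₀ hY (by omega)
  have h2 : Y ^ k' ≤ Y ^ (k + k') := pow_le_pow_right₀ hY (by omega)
  have := mul_le_mul_of_nonneg_left h1 hc
  have := mul_le_mul_of_nonneg_left h2 hc'
  linarith [(h Y hY).2, (h' Y hY).2]

lemma PB.mul {f g : ℝ → ℝ} (hf : PB f) (hg : PB g) : PB (fun Y => f Y * g Y) := by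
  obtain ⟨c, hc, k, h⟩ := hf
  obtain ⟨c', hc', k', h'⟩ := hg
  refine ⟨c * c', by positivity, k + k', fun Y hY => ⟨mul_nonneg (h Y hY).1 (h' Y hY).1, ?_⟩⟩
  refine (mul_le_mul (h Y hY).2 (h' Y hY).2 (h' Y hY).1 (by positivity)).trans (le_of_eq ?_)
  rw [pow_add]; ring

lemma PB.rpow {f : ℝ → ℝ} (hf : PB f) {e : ℝ} (he : 0 ≤ e) : PB (fun Y => f Y ^ e) := by
  obtain ⟨c, hc, k, h⟩ := hf
  refine ⟨c ^ e, by positivity, ⌈k * e⌉₊, fun Y hY => ⟨Real.rpow_nonneg (h Y hY).1 _, ?_⟩⟩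
  refine (Real.rpow_le_rpow (h Y hY).1 (h Y hY).2 he).trans ?_
  rw [Real.mul_rpow hc (by positivity)]
  refine mul_le_mul_of_nonneg_left ?_ (by positivity)
  rw [← Real.rpow_natCast, ← Real.rpow_mul (by linarith), ← Real.rpow_natCast]
  exact Real.rpow_le_rpow_of_exponent_le hY (Nat.le_ceil _)

lemma exK (a b : ℝ) : ∃ K : ℝ, 1 ≤ K ∧ a + b * Real.log K < K := by
  have h := Real.isLittleO_log_id_atTop.def (c := 1 / (2 * (|b| + 1))) (by positivity)
  obtain ⟨K, h1, h2⟩ := (h.and (Filter.eventually_ge_atTop (2 * |a| + 1))).exists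
  have hK : 1 ≤ K := by linarith [abs_nonneg a]
  refine ⟨K, hK, ?_⟩
  simp only [id, Real.norm_eq_abs, abs_of_nonneg (by linarith : 0 ≤ K)] at h1
  have h3 : b * Real.log K ≤ |b| * |Real.log K| := by rw [← abs_mul]; exact le_abs_self _
  have h4 : |b| * |Real.log K| ≤ (|b| + 1) * (1 / (2 * (|b| + 1)) * K) :=
    mul_le_mul (by linarith) h1 (abs_nonneg _) (by positivity)
  have h5 : (|b| + 1) * (1 / (2 * (|b| + 1)) * K) = K / 2 := by
    have : |b| + 1 ≠ 0 := by positivity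
    field_simp
  linarith [le_abs_self a]

lemma numeric (c K : ℝ) (κ N M D : ℕ) (hc : 1 ≤ c) (hK : 1 ≤ K) (hN : 2 ≤ N)
    (hM : K * N * Real.log N ≤ M) (hD : (D : ℝ) + 1 ≤ c * (K * N) ^ κ)
    (hKb : 4 * (3 + 2 * Real.log c + κ) + 8 * κ * Real.log K < K) :
    16 * (121 / 81) ^ M * ((D : ℝ) + 1) ^ N < (2 : ℝ) ^ M := by
  have hN' : (2 : ℝ) ≤ N := by exact_mod_cast hN
  have hl2 := Real.log_two_gt_d9
  have hl2' := Real.log_two_lt_d9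
  have hlN : 1 / 2 ≤ Real.log N := by
    have := Real.log_le_log (by norm_num) hN'
    linarith
  have hD0 : (0 : ℝ) < (D : ℝ) + 1 := by positivity
  have hlc : 0 ≤ Real.log c := Real.log_nonneg hc
  have hlK : 0 ≤ Real.log K := Real.log_nonneg hK
  have hlD : Real.log ((D : ℝ) + 1) ≤ Real.log c + κ * (Real.log K + Real.log N) := by
    refine (Real.log_le_log hD0 hD).trans (le_of_eq ?_)
    rw [Real.log_mul (by positivity) (by positivity), Real.log_pow, Real.log_mul (by positivity) (by positivity)]
  rw [← Real.log_lt_log_iff (by positivity) (by positivity), Real.log_mul (by positivity) (by positivity),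
    Real.log_mul (by norm_num) (by positivity), Real.log_pow, Real.log_pow, Real.log_pow]
  have h16 : Real.log 16 ≤ 3 := by
    have : (16 : ℝ) = 2 ^ 4 := by norm_num
    rw [this, Real.log_pow]; norm_num; linarith
  have hr : Real.log (121 / 81) + 1 / 4 ≤ Real.log 2 := by
    have h := Real.one_sub_inv_le_log_of_pos (show (0:ℝ) < 162 / 121 by norm_num)
    have e : Real.log 2 = Real.log (121 / 81) + Real.log (162 / 121) := by
      rw [← Real.log_mul (by norm_num) (by norm_num)]; norm_num
    rw [e]; norm_num at h ⊢; linarith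
  have hM0 : (0 : ℝ) ≤ M := by positivity
  set l := Real.log N with hl
  have hNl : 1 ≤ N * l := by nlinarith
  have hmain : Real.log 16 + N * Real.log ((D : ℝ) + 1) < M * (1 / 4) := by
    have a1 : N * Real.log ((D : ℝ) + 1) ≤ N * (Real.log c + κ * (Real.log K + l)) :=
      mul_le_mul_of_nonneg_left hlD (by positivity)
    have a2 : N * Real.log c ≤ 2 * Real.log c * (N * l) := by
      have : 0 ≤ N * Real.log c := by positivity
      nlinarith
    have a3 : N * (κ * Real.log K) ≤ 2 * κ * Real.log K * (N * l) := by
      have : 0 ≤ N * (κ * Real.log K) := by positivity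
      nlinarith
    have a4 : (4 * (3 + 2 * Real.log c + κ) + 8 * κ * Real.log K) * (N * l) < K * (N * l) :=
      mul_lt_mul_of_pos_right hKb (by linarith)
    nlinarith
  have hr' := mul_le_mul_of_nonneg_left hr hM0
  nlinarith

lemma small_bound (x T : ℝ) (M D : ℕ) (hM : 1 ≤ M) (hx0 : 0 ≤ x) (hx : x ≤ Real.exp T)
    (hD : 2 * (T + 2) * M ≤ D) :
    x ^ M * (1 / 2) ^ D ≤ 1 / 2 * (9 / 10) ^ M := by
  have h1 : x ^ M ≤ Real.exp (M * T) := by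
    rw [Real.exp_nat_mul]; exact pow_le_pow_left₀ hx0 hx M
  have h2 : (1 / 2 : ℝ) ^ D ≤ Real.exp (-(T + 2) * M) := by
    have h3 : (1 / 2 : ℝ) ≤ Real.exp (-(1 / 2)) := by
      have := Real.add_one_le_exp (-(1 / 2 : ℝ)); linarith
    calc (1 / 2 : ℝ) ^ D ≤ (Real.exp (-(1 / 2))) ^ D := pow_le_pow_left₀ (by norm_num) h3 D
      _ = Real.exp (D * (-(1 / 2))) := by rw [Real.exp_nat_mul]
      _ ≤ _ := Real.exp_le_exp.2 (by linarith)
  have h4 : Real.exp (-2) ≤ 1 / 3 := by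
    rw [Real.exp_neg]
    have := Real.add_one_le_exp (2 : ℝ)
    rw [inv_eq_one_div]
    exact one_div_le_one_div_of_le (by norm_num) (by linarith)
  calc x ^ M * (1 / 2) ^ D ≤ Real.exp (M * T) * Real.exp (-(T + 2) * M) :=
        mul_le_mul h1 h2 (by positivity) (by positivity)
    _ = (Real.exp (-2)) ^ M := by rw [← Real.exp_add, ← Real.exp_nat_mul]; congr 1; ring
    _ ≤ (1 / 2 * (9 / 10)) ^ M := pow_le_pow_left₀ (Real.exp_pos _).le (by linarith) M
    _ = (1 / 2) ^ M * (9 / 10) ^ M := mul_pow _ _ _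
    _ ≤ 1 / 2 * (9 / 10) ^ M := by
        refine mul_le_mul_of_nonneg_right ?_ (by positivity)
        calc (1 / 2 : ℝ) ^ M ≤ (1 / 2) ^ 1 := pow_le_pow_of_le_one (by norm_num) (by norm_num) hM
          _ = 1 / 2 := by norm_num

lemma local_step {N M D : ℕ} (ψ ψx : ℝ → (Fin N → ℂ) → ℂ) (β a Kq E F : ℝ) (hβ : 0 < β) (ha : 0 < a)
    (hKq : 0 ≤ Kq) (hF : 0 < F)
    (hder : ∀ ζ : Fin N → ℂ, ∀ x ∈ I01, HasDerivWithinAt (fun x' => ψ x' ζ) (ψx x ζ) I01 x)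
    (hcx : ∀ ζ : Fin N → ℂ, ContinuousOn (fun x => ψx x ζ) I01)
    (han : ∀ x ∈ I01, AnalyticOnNhd ℂ (fun ζ => ψ x ζ) univ)
    (hanx : ∀ x ∈ I01, AnalyticOnNhd ℂ (fun ζ => ψx x ζ) univ)
    (x : Fin M → ℝ) (hx : ∀ i, x i ∈ I01) (Z : (Fin M → Bool) → Fin N → ℝ)
    (hq : ∀ σ, ∀ x ∈ I01, ‖ψx x (fun j => (Z σ j : ℂ)) / ψ x (fun j => (Z σ j : ℂ))‖ ≤ Kq)
    (hnode : ∀ σ i, ‖((a * sgb (σ i) : ℝ) : ℂ) - ((1 / β : ℝ) : ℂ) *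
      (ψx (x i) (fun j => (Z σ j : ℂ)) / ψ (x i) (fun j => (Z σ j : ℂ)))‖ ≤ a / 10)
    (hE : ∀ σ (z : ℂ), ‖z‖ ≤ 2 → ∀ x ∈ I01, ‖ψ x (z • (fun j => (Z σ j : ℂ)))‖ ≤ E)
    (hEx : ∀ σ (z : ℂ), ‖z‖ ≤ 2 → ∀ x ∈ I01, ‖ψx x (z • (fun j => (Z σ j : ℂ)))‖ ≤ E)
    (h0 : ∀ σ, ‖(ψ 0 (fun j => (Z σ j : ℂ)))⁻¹‖ ≤ F)
    (hsmall : (E ^ 2 * (1 + 1 / (β * a)) * (F * Real.exp Kq) ^ 2) ^ M * (1 / 2) ^ D ≤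
      1 / 2 * (9 / 10) ^ M) :
    (2 : ℝ) ^ M ≤ 16 * (121 / 81) ^ M * ((D : ℝ) + 1) ^ N := by
  have hba : 0 < β * a := mul_pos hβ ha
  have habs : ∀ b, |sgb b| = 1 := by intro b; cases b <;> simp [sgb]
  have hne : ∀ σ i, ψ (x i) (fun j => (Z σ j : ℂ)) ≠ 0 := by
    intro σ i hz
    have := hnode σ i
    rw [hz, div_zero, mul_zero, sub_zero, Complex.norm_real, Real.norm_eq_abs, abs_mul, habs,
      abs_of_pos ha] at this
    linarith
  have hlow : ∀ σ i, (F * Real.exp Kq)⁻¹ ≤ ‖ψ (x i) (fun j => (Z σ j : ℂ))‖ := by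
    intro σ i
    obtain ⟨g1, g2⟩ := gron (fun x => ψ x (fun j => (Z σ j : ℂ))) (fun x => ψx x (fun j => (Z σ j : ℂ)))
      Kq hKq (hder _) (hcx _) (hq σ) (x i) (hx i) (hne σ i)
    have h1 := h0 σ
    rw [norm_inv] at h1
    have hp : 0 < ‖ψ 0 (fun j => (Z σ j : ℂ))‖ := norm_pos_iff.2 g1
    have h2 : 1 ≤ F * ‖ψ 0 (fun j => (Z σ j : ℂ))‖ := by
      rwa [inv_le_iff_one_le_mul₀ hp] at h1
    rw [inv_le_iff_one_le_mul₀ (by positivity)]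
    have := mul_le_mul_of_nonneg_left g2 hF.le
    nlinarith
  have hcj : ∀ z : ℂ, ‖z‖ ≤ 2 → ‖(starRingEnd ℂ) z‖ ≤ 2 := fun z hz => by
    rwa [Complex.norm_conj]
  have PTp := fun i => PT.of_analytic (han (x i) (hx i))
  have PTx := fun i => PT.of_analytic (hanx (x i) (hx i))
  have hX : 0 ≤ 1 / (β * a) := by positivity
  refine core (D := D)
    (n := fun i ζ z => ((1 / (2 * (β * a)) : ℝ) : ℂ) *
      (ψx (x i) (z • (fun j => (ζ j : ℂ))) *
          (starRingEnd ℂ) (ψ (x i) ((starRingEnd ℂ) z • (fun j => (ζ j : ℂ)))) +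
        (starRingEnd ℂ) (ψx (x i) ((starRingEnd ℂ) z • (fun j => (ζ j : ℂ)))) *
          ψ (x i) (z • (fun j => (ζ j : ℂ)))))
    (d := fun i ζ z => ψ (x i) (z • (fun j => (ζ j : ℂ))) *
          (starRingEnd ℂ) (ψ (x i) ((starRingEnd ℂ) z • (fun j => (ζ j : ℂ)))))
    (fun i => (PT.const _).mul (((PTx i).mul (PTp i).conj).add ((PTx i).conj.mul (PTp i))))
    (fun i => (PTp i).mul (PTp i).conj) Z (E ^ 2 * (1 + 1 / (β * a))) (((F * Real.exp Kq)⁻¹) ^ 2)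
    (by positivity) (fun i σ z hz => ?_) (fun i σ z hz => ?_) (fun i σ => ?_)
    (fun i σ => (ψx (x i) (fun j => (Z σ j : ℂ)) / ψ (x i) (fun j => (Z σ j : ℂ))).re / (β * a))
    (fun i σ => ?_) (fun i σ => ?_) ?_
  · have e1 := hE σ z hz _ (hx i)
    have e2 := hE σ _ (hcj z hz) _ (hx i)
    have e3 := hEx σ z hz _ (hx i)
    have e4 := hEx σ _ (hcj z hz) _ (hx i)
    have hE0 : 0 ≤ E := (norm_nonneg _).trans e1
    rw [norm_mul, Complex.norm_real, Real.norm_eq_abs, abs_of_pos (by positivity)]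
    have b1 : ‖ψx (x i) (z • (fun j => (Z σ j : ℂ))) *
          (starRingEnd ℂ) (ψ (x i) ((starRingEnd ℂ) z • (fun j => (Z σ j : ℂ))))‖ ≤ E * E := by
      rw [norm_mul, Complex.norm_conj]; exact mul_le_mul e3 e2 (norm_nonneg _) hE0
    have b2 : ‖(starRingEnd ℂ) (ψx (x i) ((starRingEnd ℂ) z • (fun j => (Z σ j : ℂ)))) *
          ψ (x i) (z • (fun j => (Z σ j : ℂ)))‖ ≤ E * E := by
      rw [norm_mul, Complex.norm_conj]; exact mul_le_mul e4 e1 (norm_nonneg _) hE0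
    have b3 := (norm_add_le (ψx (x i) (z • (fun j => (Z σ j : ℂ))) *
          (starRingEnd ℂ) (ψ (x i) ((starRingEnd ℂ) z • (fun j => (Z σ j : ℂ)))))
          ((starRingEnd ℂ) (ψx (x i) ((starRingEnd ℂ) z • (fun j => (Z σ j : ℂ)))) *
          ψ (x i) (z • (fun j => (Z σ j : ℂ))))).trans (add_le_add b1 b2)
    refine (mul_le_mul_of_nonneg_left b3 (by positivity)).trans ?_
    have e5 : 1 / (2 * (β * a)) * (E * E + E * E) = E ^ 2 * (1 / (β * a)) := by
      field_simp; ring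
    rw [e5]
    exact mul_le_mul_of_nonneg_left (by linarith) (by positivity)
  · have e1 := hE σ z hz _ (hx i)
    have e2 := hE σ _ (hcj z hz) _ (hx i)
    have hE0 : 0 ≤ E := (norm_nonneg _).trans e1
    rw [norm_mul, Complex.norm_conj]
    have := mul_le_mul e1 e2 (norm_nonneg _) hE0
    have : 0 ≤ E ^ 2 * (1 / (β * a)) := by positivity
    nlinarith
  · simp only [map_one, one_smul]
    rw [norm_mul, Complex.norm_conj, ← sq]
    exact pow_le_pow_left₀ (by positivity) (hlow σ i) 2
  · simp only [map_one, one_smul]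
    have hp := hne σ i
    set p := ψ (x i) (fun j => (Z σ j : ℂ)) with hpdef
    set q := ψx (x i) (fun j => (Z σ j : ℂ)) with hqdef
    set w := q / p with hw
    have hqw : q = w * p := by rw [hw]; field_simp
    have hadd := Complex.add_conj w
    rw [hqw, map_mul]
    have e1 : w * p * (starRingEnd ℂ) p + (starRingEnd ℂ) w * (starRingEnd ℂ) p * p =
        (w + (starRingEnd ℂ) w) * (p * (starRingEnd ℂ) p) := by ring
    rw [e1, hadd]
    push_cast
    have hβ' : (β : ℂ) ≠ 0 := by exact_mod_cast hβ.ne'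
    have ha' : (a : ℂ) ≠ 0 := by exact_mod_cast ha.ne'
    field_simp
  · have h1 := (Complex.abs_re_le_norm _).trans (hnode σ i)
    rw [Complex.sub_re, Complex.ofReal_re, Complex.re_ofReal_mul] at h1
    set r := (ψx (x i) (fun j => (Z σ j : ℂ)) / ψ (x i) (fun j => (Z σ j : ℂ))).re with hr
    have e : a * sgb (σ i) - 1 / β * r = - (a * (r / (β * a) - sgb (σ i))) := by
      field_simp; ring
    rw [e, abs_neg, abs_mul, abs_of_pos ha] at h1
    have h2 : a * |r / (β * a) - sgb (σ i)| ≤ a * (1 / 10) := by linarith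
    exact le_of_mul_le_mul_left h2 ha
  · have e : E ^ 2 * (1 + 1 / (β * a)) / ((F * Real.exp Kq)⁻¹) ^ 2 =
        E ^ 2 * (1 + 1 / (β * a)) * (F * Real.exp Kq) ^ 2 := by
      rw [inv_pow, div_inv_eq_mul]
    rw [e]; exact hsmall

set_option maxHeartbeats 4000000

/-- **Lower bound for approximation of antiderivatives by logarithmic-derivative
families (first order).** No family of the form `(1/b_N)((∂ₓψ)/ψ)`, with `ψ` entire of
exponential type in `ζ ∈ ℂ^N` and `1/ψ(0,ζ)` at most exponentially large, can approximate
all antiderivatives `∫₀^x h` of `h ∈ Λ_l([0,1])` on `{|ζ_j| ≤ B₁N^{r₁}}` better than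
`C̃/(N^{l+1}(ln N)^{l+1})`; the extremal `h` vanishes on `[0,1/20]`. -/
theorem stmt_5 (m : ℕ) (hm : 1 ≤ m) (α : ℝ) (hα0 : 0 < α) (hα1 : α ≤ 1)
    (A u v b t d : ℝ) (hA : 1 ≤ A) (hu : 1 ≤ u) (hv : 1 ≤ v) (hb : 1 ≤ b)
    (ht : 1 ≤ t) (hd : 1 ≤ d)
    (B₁ r₁ : ℝ) (hB₁ : 1 ≤ B₁) (hr₁ : 1 ≤ r₁)
    (C₀ α₀ β₀ : ℝ) (hC₀ : 0 < C₀) (hα₀ : 0 < α₀) (hβ₀ : 0 < β₀)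
    (Cb pb : ℝ) (hCb : 0 < Cb) (hpb : 0 < pb) :
    ∃ C' : ℝ, 0 < C' ∧
      ∀ N : ℕ, 2 ≤ N →
      ∀ ψ ψx : ℝ → (Fin N → ℂ) → ℂ, ∀ β : ℝ,
      -- ψ is C¹ in x with x-derivative ψx, both continuous in x
      (∀ ζ : Fin N → ℂ, ∀ x ∈ I01, HasDerivWithinAt (fun x' => ψ x' ζ) (ψx x ζ) I01 x) →
      (∀ ζ : Fin N → ℂ, ContinuousOn (fun x => ψ x ζ) I01) →
      (∀ ζ : Fin N → ℂ, ContinuousOn (fun x => ψx x ζ) I01) →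
      -- ψ and ∂ₓψ are entire in ζ
      (∀ x ∈ I01, AnalyticOnNhd ℂ (fun ζ => ψ x ζ) univ) →
      (∀ x ∈ I01, AnalyticOnNhd ℂ (fun ζ => ψx x ζ) univ) →
      -- exponential growth bound for ψ and ∂ₓψ
      (∀ ζ : Fin N → ℂ, ∀ x ∈ I01,
        ‖ψ x ζ‖ ≤ A * Real.exp (u * (N:ℝ) ^ v) *
          Real.exp (b * (N:ℝ) ^ t * (∑ j, ‖ζ j‖) ^ d)) →
      (∀ ζ : Fin N → ℂ, ∀ x ∈ I01,
        ‖ψx x ζ‖ ≤ A * Real.exp (u * (N:ℝ) ^ v) *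
          Real.exp (b * (N:ℝ) ^ t * (∑ j, ‖ζ j‖) ^ d)) →
      -- |1/ψ(0,ζ)| is at most exponentially large
      (∀ ζ : Fin N → ℝ, (∀ j, |ζ j| ≤ B₁ * (N:ℝ) ^ r₁) →
        ‖(ψ 0 (fun j => (ζ j : ℂ)))⁻¹‖ ≤ C₀ * Real.exp (α₀ * (N:ℝ) ^ β₀)) →
      -- b_N and 1/b_N are positive and polynomially bounded
      (0 < β ∧ β ≤ Cb * (N:ℝ) ^ pb ∧ 1 / β ≤ Cb * (N:ℝ) ^ pb) →
      ∃ h : ℝ → ℝ, HolderClass1 m α h ∧ (∀ x ∈ Icc (0:ℝ) (1/20), h x = 0) ∧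
        ∀ ζ : Fin N → ℝ, (∀ j, |ζ j| ≤ B₁ * (N:ℝ) ^ r₁) →
          ∃ x ∈ I01,
            C' / ((N:ℝ) ^ ((m:ℝ) + α + 1) * (Real.log N) ^ ((m:ℝ) + α + 1)) ≤
              ‖((∫ s in (0:ℝ)..x, h s : ℝ) : ℂ) - ((1 / β : ℝ) : ℂ) *
                (ψx x (fun j => (ζ j : ℂ)) / ψ x (fun j => (ζ j : ℂ)))‖ := by
  obtain ⟨L, hL1, hbump⟩ := bump_family m
  set e : ℝ := (m : ℝ) + α + 1 with he
  have he0 : 0 ≤ e := by positivity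
  -- the polynomial growth function
  let T : ℝ → ℝ := fun Y => 2 * (A + u * Y ^ v + b * Y ^ t * (2 * (Y * (B₁ * Y ^ r₁))) ^ d) +
    Cb * Y ^ pb * (2 * L * (4 * (Y * Y)) ^ e) + 2 * (C₀ + α₀ * Y ^ β₀ + 2 * Cb * Y ^ pb)
  have k0 : ∀ {c : ℝ}, 0 ≤ c → PB (fun _ => c) := fun h => PB.const h
  have hT : PB T := by
    have hr : ∀ {s : ℝ}, 0 ≤ s → PB (fun Y => Y ^ s) := fun h => PB.id.rpow h
    have f1 := (k0 (by linarith : 0 ≤ u)).mul (hr (by linarith : 0 ≤ v))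
    have f2 := (k0 (by norm_num : (0:ℝ) ≤ 2)).mul
      (PB.id.mul ((k0 (by linarith : 0 ≤ B₁)).mul (hr (by linarith : 0 ≤ r₁))))
    have f3 := ((k0 (by linarith : 0 ≤ b)).mul (hr (by linarith : 0 ≤ t))).mul
      (f2.rpow (by linarith : 0 ≤ d))
    have f4 := (k0 (by norm_num : (0:ℝ) ≤ 2)).mul (((k0 (by linarith : 0 ≤ A)).add f1).add f3)
    have f5 := (k0 (by positivity : 0 ≤ 2 * L)).mul
      (((k0 (by norm_num : (0:ℝ) ≤ 4)).mul (PB.id.mul PB.id)).rpow he0)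
    have f6 := ((k0 hCb.le).mul (hr hpb.le)).mul f5
    have f7 := (k0 (by norm_num : (0:ℝ) ≤ 2)).mul (((k0 hC₀.le).add ((k0 hα₀.le).mul (hr hβ₀.le))).add
      ((k0 (by positivity : 0 ≤ 2 * Cb)).mul (hr hpb.le)))
    exact (f4.add f6).add f7
  obtain ⟨c₁, hc₁0, κ, hgb⟩ : PB (fun Y => 2 * (T Y + 2) * (2 * (Y * Y)) + 2) :=
    (((k0 (by norm_num : (0:ℝ) ≤ 2)).mul (hT.add (k0 (by norm_num : (0:ℝ) ≤ 2)))).mul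
      ((k0 (by norm_num : (0:ℝ) ≤ 2)).mul (PB.id.mul PB.id))).add (k0 (by norm_num : (0:ℝ) ≤ 2))
  obtain ⟨c, hc1, hg⟩ : ∃ c : ℝ, 1 ≤ c ∧ ∀ Y : ℝ, 1 ≤ Y →
      2 * (T Y + 2) * (2 * (Y * Y)) + 2 ≤ c * Y ^ κ := by
    refine ⟨c₁ + 1, by linarith, fun Y hY => (hgb Y hY).2.trans ?_⟩
    exact mul_le_mul_of_nonneg_right (by linarith) (by positivity)
  obtain ⟨K, hK1, hKb⟩ := exK (4 * (3 + 2 * Real.log c + κ)) (8 * κ)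
  have hTnn : ∀ Y, 1 ≤ Y → 0 ≤ T Y := by
    obtain ⟨_, _, _, h⟩ := hT
    exact fun Y hY => (h Y hY).1
  refine ⟨1 / 10 * (1 / (2 * L * (4 * K) ^ e)), by positivity, ?_⟩
  intro N hN ψ ψx β hder _ hcx han hanx hgr hgrx h0 hβ
  obtain ⟨hβ0, hβ1, hβ2⟩ := hβ
  have hN' : (2 : ℝ) ≤ N := by exact_mod_cast hN
  have hN1 : (1 : ℝ) ≤ N := by linarith
  set l := Real.log N with hl
  have hl2 := Real.log_two_gt_d9
  have hlN : 1 / 2 ≤ l := by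
    have := Real.log_le_log (by norm_num) hN'
    linarith
  have hlN2 : l ≤ N := by
    have := Real.log_le_sub_one_of_pos (show (0:ℝ) < N by linarith)
    linarith
  have hNl : 1 ≤ K * N * l := by
    have h1 : 1 ≤ N * l := by nlinarith
    nlinarith
  set M : ℕ := ⌈K * N * l⌉₊ with hMdef
  have hM1 : K * N * l ≤ M := Nat.le_ceil _
  have hM2 : (M : ℝ) ≤ 2 * (K * N * l) := by
    have := Nat.ceil_lt_add_one (show 0 ≤ K * N * l by linarith)
    linarith
  have hM1' : (1 : ℝ) ≤ M := hNl.trans hM1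
  have hMpos : 1 ≤ M := by exact_mod_cast hM1'
  set Y : ℝ := K * N with hY
  have hNY : (N : ℝ) ≤ Y := by rw [hY]; nlinarith
  have hY1 : 1 ≤ Y := by linarith
  have hMY : (M : ℝ) ≤ 2 * (Y * Y) := by
    have : Y * l ≤ Y * Y := mul_le_mul_of_nonneg_left (hlN2.trans hNY) (by linarith)
    linarith
  obtain ⟨x, hx, hfam⟩ := hbump α hα0 hα1 M hMpos
  set Wd : ℝ := 2 * L * (2 * (M : ℝ)) ^ e with hWd
  have h2Mpos : 1 ≤ (2 * (M : ℝ)) ^ e := Real.one_le_rpow (by linarith) he0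
  have hWd1 : 1 ≤ Wd := by nlinarith
  set a : ℝ := 1 / Wd with ha
  have ha0 : 0 < a := by positivity
  have ha1 : a ≤ 1 := by rw [ha, div_le_one (by linarith)]; exact hWd1
  have haW : a * Wd = 1 := by rw [ha]; field_simp
  set ε : ℝ := 1 / 10 * (1 / (2 * L * (4 * K) ^ e)) / ((N : ℝ) ^ e * l ^ e) with hε
  have hεa : ε ≤ a / 10 := by
    have h1 : (2 * (M : ℝ)) ^ e ≤ (4 * K) ^ e * ((N : ℝ) ^ e * l ^ e) := by
      rw [← Real.mul_rpow (by positivity) (by linarith), ← Real.mul_rpow (by positivity) (by nlinarith)]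
      refine Real.rpow_le_rpow (by positivity) ?_ he0
      linarith
    have h2 : ε = 1 / 10 * (1 / (2 * L * ((4 * K) ^ e * ((N : ℝ) ^ e * l ^ e)))) := by
      have : (0:ℝ) < (N : ℝ) ^ e := by positivity
      have : (0:ℝ) < l ^ e := Real.rpow_pos_of_pos (by linarith) _
      have : (0:ℝ) < (4 * K) ^ e := by positivity
      rw [hε]; field_simp
    rw [h2, ha]
    have h3 : 1 / (2 * L * ((4 * K) ^ e * ((N : ℝ) ^ e * l ^ e))) ≤ 1 / Wd := by
      apply one_div_le_one_div_of_le (by linarith)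
      rw [hWd]
      exact mul_le_mul_of_nonneg_left h1 (by positivity)
    linarith
  by_contra hcon
  push Not at hcon
  choose h hh1 hh2 hh3 hh4 using fun σ => hfam σ a ha0 haW
  choose Z hZ1 hZ2 using fun σ => hcon (h σ) (hh1 σ) (hh2 σ)
  set D : ℕ := ⌈2 * (T Y + 2) * M⌉₊ with hD
  have hTY := hTnn Y hY1
  have hD1 : 2 * (T Y + 2) * M ≤ D := Nat.le_ceil _
  have hD2 : (D : ℝ) + 1 ≤ c * Y ^ κ := by
    have h1 := Nat.ceil_lt_add_one (show 0 ≤ 2 * (T Y + 2) * M by positivity)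
    have h2 : 2 * (T Y + 2) * M ≤ 2 * (T Y + 2) * (2 * (Y * Y)) :=
      mul_le_mul_of_nonneg_left hMY (by linarith)
    linarith [hg Y hY1]
  have hnum := numeric c K κ N M D hc1 hK1 hN hM1 hD2 hKb
  refine absurd ?_ (not_le.2 hnum)
  set X : ℝ := 2 * (N * (B₁ * (N : ℝ) ^ r₁)) with hX
  have hX0 : 0 ≤ X := by positivity
  have hsumX : ∀ σ (z : ℂ), ‖z‖ ≤ 2 → ∑ j, ‖(z • (fun j => (Z σ j : ℂ))) j‖ ≤ X := by
    intro σ z hz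
    calc ∑ j, ‖(z • (fun j => (Z σ j : ℂ))) j‖ ≤ ∑ j : Fin N, 2 * (B₁ * (N : ℝ) ^ r₁) := by
          refine Finset.sum_le_sum fun j _ => ?_
          rw [Pi.smul_apply, smul_eq_mul, norm_mul, Complex.norm_real, Real.norm_eq_abs]
          exact mul_le_mul hz (hZ1 σ j) (abs_nonneg _) (by norm_num)
      _ = X := by
          rw [Finset.sum_const, nsmul_eq_mul, Finset.card_univ, Fintype.card_fin, hX]; ring
  have hgrow : ∀ σ (z : ℂ), ‖z‖ ≤ 2 → A * Real.exp (u * (N:ℝ) ^ v) *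
      Real.exp (b * (N:ℝ) ^ t * (∑ j, ‖(z • (fun j => (Z σ j : ℂ))) j‖) ^ d) ≤
      A * Real.exp (u * (N:ℝ) ^ v) * Real.exp (b * (N:ℝ) ^ t * X ^ d) := by
    intro σ z hz
    refine mul_le_mul_of_nonneg_left (Real.exp_le_exp.2 ?_) (by positivity)
    refine mul_le_mul_of_nonneg_left ?_ (by positivity)
    exact Real.rpow_le_rpow (Finset.sum_nonneg fun _ _ => norm_nonneg _) (hsumX σ z hz) (by linarith)
  refine local_step ψ ψx β a (2 * Cb * (N:ℝ) ^ pb)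
    (A * Real.exp (u * (N:ℝ) ^ v) * Real.exp (b * (N:ℝ) ^ t * X ^ d))
    (C₀ * Real.exp (α₀ * (N:ℝ) ^ β₀)) hβ0 ha0 (by positivity) (by positivity) hder hcx han hanx
    x hx Z ?_ ?_ ?_ ?_ ?_ ?_
  · intro σ y hy
    have h1 := hZ2 σ y hy
    set w := ψx y (fun j => (Z σ j : ℂ)) / ψ y (fun j => (Z σ j : ℂ)) with hw
    have h2 : ‖((1 / β : ℝ) : ℂ) * w‖ ≤ 2 := by
      have h3 := norm_le_norm_add_norm_sub' (((1 / β : ℝ) : ℂ) * w) ((∫ s in (0:ℝ)..y, h σ s : ℝ) : ℂ)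
      rw [norm_sub_rev (((1 / β : ℝ) : ℂ) * w)] at h3
      have h4 : ‖((∫ s in (0:ℝ)..y, h σ s : ℝ) : ℂ)‖ ≤ a := by
        rw [Complex.norm_real, Real.norm_eq_abs]; exact hh3 σ y hy
      linarith
    rw [norm_mul, Complex.norm_real, Real.norm_eq_abs, abs_of_pos (by positivity),
      one_div, inv_mul_le_iff₀ hβ0] at h2
    linarith
  · intro σ i
    have h1 := hZ2 σ (x i) (hx i)
    rw [hh4 σ i] at h1
    exact h1.le.trans hεa
  · intro σ z hz y hy
    exact (hgr _ y hy).trans (hgrow σ z hz)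
  · intro σ z hz y hy
    exact (hgrx _ y hy).trans (hgrow σ z hz)
  · intro σ
    exact h0 (Z σ) (hZ1 σ)
  · refine small_bound _ (T Y) M D hMpos (by positivity) ?_ hD1
    have hAe : A ≤ Real.exp A := by linarith [Real.add_one_le_exp A]
    have hCe : C₀ ≤ Real.exp C₀ := by linarith [Real.add_one_le_exp C₀]
    have hpw : ∀ s : ℝ, 0 ≤ s → (N : ℝ) ^ s ≤ Y ^ s := fun s hs =>
      Real.rpow_le_rpow (by linarith) hNY hs
    have q1 : A * Real.exp (u * (N:ℝ) ^ v) * Real.exp (b * (N:ℝ) ^ t * X ^ d) ≤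
        Real.exp (A + u * Y ^ v + b * Y ^ t * (2 * (Y * (B₁ * Y ^ r₁))) ^ d) := by
      rw [Real.exp_add, Real.exp_add]
      refine mul_le_mul (mul_le_mul hAe (Real.exp_le_exp.2 ?_) (by positivity) (by positivity))
        (Real.exp_le_exp.2 ?_) (by positivity) (by positivity)
      · exact mul_le_mul_of_nonneg_left (hpw v (by linarith)) (by linarith)
      · have hXY : X ≤ 2 * (Y * (B₁ * Y ^ r₁)) := by
          rw [hX]
          refine mul_le_mul_of_nonneg_left ?_ (by norm_num)
          refine mul_le_mul hNY ?_ (by positivity) (by linarith)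
          exact mul_le_mul_of_nonneg_left (hpw r₁ (by linarith)) (by linarith)
        refine mul_le_mul (mul_le_mul_of_nonneg_left (hpw t (by linarith)) (by linarith))
          (Real.rpow_le_rpow hX0 hXY (by linarith)) (by positivity) (by positivity)
    have q2 : 1 + 1 / (β * a) ≤ Real.exp (Cb * Y ^ pb * (2 * L * (4 * (Y * Y)) ^ e)) := by
      have h1 : 1 / (β * a) = 1 / β * Wd := by rw [ha]; field_simp
      have h2 : 1 / (β * a) ≤ Cb * Y ^ pb * (2 * L * (4 * (Y * Y)) ^ e) := by
        rw [h1]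
        refine mul_le_mul (hβ2.trans (mul_le_mul_of_nonneg_left (hpw pb hpb.le) hCb.le)) ?_
          (by linarith) (by positivity)
        rw [hWd]
        refine mul_le_mul_of_nonneg_left ?_ (by positivity)
        exact Real.rpow_le_rpow (by positivity) (by linarith) he0
      linarith [Real.add_one_le_exp (Cb * Y ^ pb * (2 * L * (4 * (Y * Y)) ^ e))]
    have q3 : C₀ * Real.exp (α₀ * (N:ℝ) ^ β₀) * Real.exp (2 * Cb * (N:ℝ) ^ pb) ≤
        Real.exp (C₀ + α₀ * Y ^ β₀ + 2 * Cb * Y ^ pb) := by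
      rw [Real.exp_add, Real.exp_add]
      refine mul_le_mul (mul_le_mul hCe (Real.exp_le_exp.2 ?_) (by positivity) (by positivity))
        (Real.exp_le_exp.2 ?_) (by positivity) (by positivity)
      · exact mul_le_mul_of_nonneg_left (hpw β₀ hβ₀.le) hα₀.le
      · exact mul_le_mul_of_nonneg_left (hpw pb hpb.le) (by positivity)
    have eT : Real.exp (T Y) =
        Real.exp (A + u * Y ^ v + b * Y ^ t * (2 * (Y * (B₁ * Y ^ r₁))) ^ d) ^ 2 *
        Real.exp (Cb * Y ^ pb * (2 * L * (4 * (Y * Y)) ^ e)) *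
        Real.exp (C₀ + α₀ * Y ^ β₀ + 2 * Cb * Y ^ pb) ^ 2 := by
      rw [← Real.exp_nat_mul, ← Real.exp_nat_mul, ← Real.exp_add, ← Real.exp_add]
      push_cast; rfl
    rw [eT]
    refine mul_le_mul (mul_le_mul (pow_le_pow_left₀ (by positivity) q1 2) q2 (by positivity)
      (by positivity)) (pow_le_pow_left₀ (by positivity) q3 2) (by positivity) (by positivity)

end
end
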